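/- arXiv:2104.12019 — 2 statements merged into one kernel-verified Lean document; each statement's English description precedes it below -/
import Mathlib

section
/- There exists a constant C > 0 such that for every real λ ≥ 1 and every real z, | Σ_{0 ≤ k ≤ λ + z√λ} e^{−λ} λ^k / k! − Φ(z) | ≤ C·λ^{−1/2}, where Φ(z) = (1/√(2π)) ∫_{−∞}^{z} e^{−t²/2} dt. (Equivalently: if X is a Poisson random variable with parameter λ ≥ 1, then P(X ≤ λ + z√λ) = Φ(z) + O(λ^{−1/2}) uniformly in λ and z.) -/
open Finset

/-- The number of cycles of length `j` in the permutation `σ` of `{1,…,n}`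
(fixed points count as cycles of length 1): the number of points whose
orbit under `σ` has size `j`, divided by `j`. -/
noncomputable def cycleCount {n : ℕ} (σ : Equiv.Perm (Fin n)) (j : ℕ) : ℕ :=
  (Finset.univ.filter fun x => Function.minimalPeriod (⇑σ) x = j).card / j

/-- The number of cycles of `σ` whose length lies in the set `I`. -/
noncomputable def cycleCountIn {n : ℕ} (σ : Equiv.Perm (Fin n)) (I : Finset ℕ) : ℕ :=
  ∑ j ∈ I, cycleCount σ j

/-- The total number of cycles of `σ` (fixed points included as 1-cycles). -/
noncomputable def totalCycles {n : ℕ} (σ : Equiv.Perm (Fin n)) : ℕ :=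
  cycleCountIn σ (Finset.Icc 1 n)

/-- Probability of an event under a uniformly random permutation of `{1,…,n}`. -/
noncomputable def permP (n : ℕ) (E : Equiv.Perm (Fin n) → Prop) : ℝ :=
  (Nat.card {σ : Equiv.Perm (Fin n) // E σ} : ℝ) / n.factorial

/-- Expectation of `f` under a uniformly random permutation of `{1,…,n}`. -/
noncomputable def permE (n : ℕ) (f : Equiv.Perm (Fin n) → ℝ) : ℝ :=
  (∑ σ : Equiv.Perm (Fin n), f σ) / n.factorial

/-- `H(I) = ∑_{j ∈ I} 1/j`. -/
noncomputable def Hset (I : Finset ℕ) : ℝ := ∑ j ∈ I, (1 : ℝ) / j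

/-- The harmonic sum `H_n = ∑_{i=1}^n 1/i`. -/
noncomputable def harm (n : ℕ) : ℝ := Hset (Finset.Icc 1 n)


open MeasureTheory

namespace PoissonStein

lemma hs_congr {f g : ℕ → ℝ} {a b : ℝ} (h : HasSum g b) (hfg : ∀ k, f k = g k) (hab : a = b) :
    HasSum f a := by
  have : f = g := funext hfg
  rw [this, hab]; exact h

lemma hd_congr {f g : ℝ → ℝ} {a b x : ℝ} (h : HasDerivAt g b x) (hfg : ∀ k, f k = g k)
    (hab : a = b) : HasDerivAt f a x := by
  have : f = g := funext hfg
  rw [this, hab]; exact h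

/-- The Gaussian density without normalisation. -/
noncomputable def ga (t : ℝ) : ℝ := Real.exp (-t ^ 2 / 2)

noncomputable def T (w : ℝ) : ℝ := ∫ t in Set.Iic w, ga t

noncomputable def S : ℝ := Real.sqrt (2 * Real.pi)

noncomputable def R (w : ℝ) : ℝ := Real.exp (w ^ 2 / 2) * T w

lemma ga_cont : Continuous ga := by unfold ga; fun_prop

lemma ga_pos (t : ℝ) : 0 < ga t := Real.exp_pos _

lemma ga_le (t : ℝ) : ga t ≤ 1 := by
  unfold ga; rw [Real.exp_le_one_iff]; nlinarith [sq_nonneg t]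

lemma ga_eq : ga = fun t => Real.exp (-(1/2) * t ^ 2) := by
  funext t; unfold ga; congr 1; ring

lemma ga_int : Integrable ga := by
  rw [ga_eq]; exact integrable_exp_neg_mul_sq (by norm_num)

lemma ga_tot : ∫ t, ga t = S := by
  rw [ga_eq, integral_gaussian]; unfold S; congr 1; field_simp

lemma S_ge : 1 ≤ S := by
  unfold S; rw [Real.one_le_sqrt]; nlinarith [Real.pi_gt_three]

lemma T_deriv (w : ℝ) : HasDerivAt T (ga w) w := by
  have h : T = fun w => T 0 + ∫ t in (0:ℝ)..w, ga t := by
    funext w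
    have := intervalIntegral.integral_Iic_sub_Iic (a := 0) (b := w) (f := ga) (μ := volume)
      ga_int.integrableOn ga_int.integrableOn
    unfold T; linarith
  rw [h]
  exact (intervalIntegral.integral_hasDerivAt_right (ga_cont.intervalIntegrable _ _)
    (ga_cont.stronglyMeasurableAtFilter _ _) ga_cont.continuousAt).const_add _

lemma T_nonneg (w : ℝ) : 0 ≤ T w := integral_nonneg fun t => (ga_pos t).le

lemma T_neg (w : ℝ) : T w + T (-w) = S := by
  have h1 : T (-w) = ∫ t in Set.Ioi w, ga t := by
    unfold T
    have := integral_comp_neg_Iic (-w) ga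
    rw [neg_neg] at this
    rw [← this]; congr 1; funext t; simp [ga]
  rw [h1, ← ga_tot]; unfold T
  exact intervalIntegral.integral_Iic_add_Ioi ga_int.integrableOn ga_int.integrableOn

lemma T_mono : Monotone T :=
  monotone_of_hasDerivAt_nonneg T_deriv (fun t => (ga_pos t).le)

lemma T_le (w : ℝ) : T w ≤ S := by linarith [T_neg w, T_nonneg (-w)]

lemma T_lip (z h : ℝ) (hh : 0 ≤ h) : T (z + h) ≤ T z + h := by
  have : Antitone (fun w => T w - w) :=
    antitone_of_hasDerivAt_nonpos (fun w => (T_deriv w).sub (hasDerivAt_id w))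
      (fun w => by have := ga_le w; simpa using this)
  have := this (show z ≤ z + h by linarith)
  linarith

lemma tail_bound (w : ℝ) : -w * T w ≤ ga w := by
  have hd : ∀ x, HasDerivAt ga (-x * ga x) x := by
    intro x
    have := (((hasDerivAt_id x).pow 2).neg.div_const 2).exp
    refine hd_congr this (fun t => by simp [ga]) (by simp [ga]; ring)
  have hi : Integrable (fun x => -x * ga x) := by
    have := (integrable_mul_exp_neg_mul_sq (b := 1/2) (by norm_num)).neg
    rw [ga_eq]; convert this using 1; funext x; simp
  have ht : Filter.Tendsto ga Filter.atBot (nhds 0) := by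
    have h := ga_int.integrableOn (s := Set.Iic (0:ℝ))
    exact tendsto_zero_of_hasDerivAt_of_integrableOn_Iic (a := 0) (fun x _ => hd x) hi.integrableOn h
  have := integral_Iic_of_hasDerivAt_of_tendsto' (a := w) (fun x _ => hd x) hi.integrableOn ht
  rw [sub_zero] at this
  rw [← this]; unfold T; rw [← integral_const_mul]
  apply setIntegral_mono_on (ga_int.const_mul _).integrableOn hi.integrableOn measurableSet_Iic
  intro x hx
  have := ga_pos x
  have hx : x ≤ w := hx
  nlinarith

lemma R_deriv (w : ℝ) : HasDerivAt R (w * R w + 1) w := by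
  have h1 : HasDerivAt (fun w : ℝ => Real.exp (w ^ 2 / 2)) (Real.exp (w ^ 2 / 2) * w) w := by
    have := (((hasDerivAt_id w).pow 2).div_const 2).exp
    refine hd_congr this (fun t => by simp) (by simp)
  have h := h1.mul (T_deriv w)
  have e : Real.exp (w ^ 2 / 2) * ga w = 1 := by
    unfold ga; rw [← Real.exp_add]; ring_nf; simp
  refine hd_congr h (fun t => by simp [R]) ?_
  rw [e]; unfold R; ring

lemma R_nonneg (w : ℝ) : 0 ≤ R w := mul_nonneg (Real.exp_pos _).le (T_nonneg w)

lemma R_cont : Continuous R := continuous_iff_continuousAt.2 fun w => (R_deriv w).continuousAt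

lemma R_tail (w : ℝ) : -w * R w ≤ 1 := by
  have : Real.exp (w ^ 2 / 2) * ga w = 1 := by
    unfold ga; rw [← Real.exp_add]; ring_nf; simp
  have h2 := mul_le_mul_of_nonneg_left (tail_bound w) (Real.exp_pos (w^2/2)).le
  unfold R; rw [this] at h2; linarith

lemma R_le (w : ℝ) (hw : w ≤ 0) : R w ≤ S := by
  have : MonotoneOn R (Set.Iic 0) := by
    apply monotoneOn_of_deriv_nonneg (convex_Iic 0) R_cont.continuousOn
    · intro x _; exact (R_deriv x).differentiableAt.differentiableWithinAt
    · intro x _; rw [(R_deriv x).deriv]; linarith [R_tail x]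
  have h := this (show w ∈ Set.Iic 0 from hw) (show (0:ℝ) ∈ Set.Iic 0 from Set.mem_Iic.2 le_rfl) hw
  have h0 : R 0 = T 0 := by simp [R]
  linarith [T_le 0]

/-- The solution of the Stein equation. -/
noncomputable def f (z w : ℝ) : ℝ :=
  if z ≤ w then T z / S * R (-w) else T (-z) / S * R w

lemma aux (a b : ℝ) (hab : a ≤ b) : T a / S * R (-b) ≤ R (-|b|) := by
  have hS := S_ge
  have hS0 : 0 < S := by linarith
  rcases le_total 0 b with h | h
  · rw [abs_of_nonneg h]
    have : T a / S ≤ 1 := by rw [div_le_one hS0]; exact T_le a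
    nlinarith [R_nonneg (-b)]
  · rw [abs_of_nonpos h, neg_neg]
    have h1 : T a / S * R (-b) ≤ T b / S * R (-b) := by
      apply mul_le_mul_of_nonneg_right _ (R_nonneg _)
      exact div_le_div_of_nonneg_right (T_mono hab) hS0.le
    have h2 : T b / S * R (-b) = R b * (T (-b) / S) := by
      unfold R; rw [neg_sq]; ring
    have : T (-b) / S ≤ 1 := by rw [div_le_one hS0]; exact T_le _
    nlinarith [R_nonneg b]

lemma f_nonneg (z w : ℝ) : 0 ≤ f z w := by
  have hS := S_ge
  have hS0 : 0 < S := by linarith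
  unfold f
  split_ifs <;> exact mul_nonneg (div_nonneg (T_nonneg _) hS0.le) (R_nonneg _)

lemma f_le_R (z w : ℝ) : f z w ≤ R (-|w|) := by
  unfold f
  split_ifs with h
  · exact aux z w h
  · have := aux (-z) (-w) (by linarith)
    simpa using this

lemma f_le (z w : ℝ) : f z w ≤ S :=
  (f_le_R z w).trans (R_le _ (by simp))

lemma abs_mul_f_le (z w : ℝ) : |w * f z w| ≤ 1 := by
  rw [abs_mul, abs_of_nonneg (f_nonneg z w)]
  have := R_tail (-|w|)
  rw [neg_neg] at this
  exact (mul_le_mul_of_nonneg_left (f_le_R z w) (abs_nonneg w)).trans this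

lemma f_cont (z : ℝ) : Continuous (f z) := by
  unfold f
  refine Continuous.if_le ?_ ?_ continuous_const continuous_id ?_
  · exact continuous_const.mul (R_cont.comp continuous_neg)
  · exact continuous_const.mul R_cont
  · intro x hx
    change z = x at hx
    subst hx
    unfold R; rw [neg_sq]; ring

/-- The right derivative of `f z`. -/
noncomputable def fder (z w : ℝ) : ℝ := w * f z w + (if w < z then 1 else 0) - T z / S

lemma f_deriv (z w : ℝ) : HasDerivWithinAt (f z) (fder z w) (Set.Ici w) w := by
  have hS := S_ge
  have hS0 : S ≠ 0 := by linarith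
  by_cases h : z ≤ w
  · have h1 : HasDerivAt (fun w => T z / S * R (-w)) (fder z w) w := by
      have := ((R_deriv (-w)).comp w (hasDerivAt_neg w)).const_mul (T z / S)
      refine hd_congr this (fun t => rfl) ?_
      simp only [fder, f, h, if_true, not_lt.2 h, if_false]; ring
    refine h1.hasDerivWithinAt.congr ?_ ?_
    · intro x hx; simp [f, h.trans hx]
    · simp [f, h]
  · have h1 : HasDerivAt (fun w => T (-z) / S * R w) (fder z w) w := by
      have := (R_deriv w).const_mul (T (-z) / S)
      refine hd_congr this (fun t => rfl) ?_
      have h2 := T_neg z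
      have h3 : T (-z) / S = 1 - T z / S := by field_simp; linarith
      simp only [fder, f, h, if_false, not_le.1 h, if_true, h3]; ring
    apply HasDerivAt.hasDerivWithinAt
    refine h1.congr_of_eventuallyEq ?_
    filter_upwards [gt_mem_nhds (not_le.1 h)] with x hx
    simp [f, hx]

lemma p_mem (z : ℝ) : 0 ≤ T z / S ∧ T z / S ≤ 1 := by
  have hS := S_ge
  have hS0 : 0 < S := by linarith
  exact ⟨div_nonneg (T_nonneg _) hS0.le, by rw [div_le_one hS0]; exact T_le _⟩

lemma fder_le (z w : ℝ) : |fder z w| ≤ 2 := by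
  have h1 := abs_le.1 (abs_mul_f_le z w)
  have h2 := p_mem z
  unfold fder
  rw [abs_le]
  split_ifs <;> constructor <;> linarith

lemma incr_le (z a b c : ℝ) (hab : a ≤ b) (hc : ∀ x ∈ Set.Ico a b, fder z x ≤ c) :
    f z b - f z a ≤ c * (b - a) := by
  have := image_le_of_deriv_right_le_deriv_boundary (f := f z) (f' := fder z) (a := a) (b := b)
    (B := fun x => f z a + c * (x - a)) (B' := fun _ => c) (f_cont z).continuousOn
    (fun x _ => f_deriv z x) (by simp) (by fun_prop)
    (fun x _ => by
      have := (((hasDerivAt_id x).sub_const a).const_mul c).const_add (f z a)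
      simpa using this.hasDerivWithinAt) hc (Set.right_mem_Icc.2 hab)
  linarith

lemma incr_ge (z a b c : ℝ) (hab : a ≤ b) (hc : ∀ x ∈ Set.Ico a b, c ≤ fder z x) :
    c * (b - a) ≤ f z b - f z a := by
  have := image_le_of_deriv_right_le_deriv_boundary (f := fun x => - f z x)
    (f' := fun x => - fder z x) (a := a) (b := b)
    (B := fun x => - f z a - c * (x - a)) (B' := fun _ => -c) (f_cont z).neg.continuousOn
    (fun x _ => (f_deriv z x).neg) (by simp) (by fun_prop)
    (fun x _ => by
      have := (((hasDerivAt_id x).sub_const a).const_mul c).const_sub (- f z a)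
      simpa using this.hasDerivWithinAt) (fun x hx => neg_le_neg (hc x hx))
      (Set.right_mem_Icc.2 hab)
  linarith

lemma f_lip (z a b : ℝ) (hab : a ≤ b) : |f z b - f z a| ≤ 2 * (b - a) := by
  rw [abs_le]
  have h1 := incr_le z a b 2 hab (fun x _ => (abs_le.1 (fder_le z x)).2)
  have h2 := incr_ge z a b (-2) hab (fun x _ => (abs_le.1 (fder_le z x)).1)
  constructor <;> linarith

lemma mulf_diff (z w h x : ℝ) (hx : w ≤ x) (hx' : x ≤ w + h) :
    |x * f z x - w * f z w| ≤ h * (S + 2 * |w|) := by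
  have e : x * f z x - w * f z w = (x - w) * f z x + w * (f z x - f z w) := by ring
  rw [e]
  refine (abs_add_le _ _).trans ?_
  rw [abs_mul, abs_mul, abs_of_nonneg (f_nonneg z x), abs_of_nonneg (sub_nonneg.2 hx)]
  have h1 := mul_le_mul_of_nonneg_left (f_lip z w x hx) (abs_nonneg w)
  have h2 : (x - w) * f z x ≤ h * S :=
    mul_le_mul (by linarith) (f_le z x) (f_nonneg _ _) (by linarith)
  have h3 := mul_le_mul_of_nonneg_left (show x - w ≤ h by linarith) (abs_nonneg w)
  nlinarith

lemma step_le (z w h : ℝ) (hh : 0 ≤ h) :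
    f z (w + h) - f z w ≤
      h * (w * f z w + (if w ≤ z then 1 else 0) - T z / S + h * (S + 2 * |w|)) := by
  have := incr_le z w (w + h)
    (w * f z w + (if w ≤ z then 1 else 0) - T z / S + h * (S + 2 * |w|)) (by linarith) ?_
  · linarith
  intro x hx
  have h1 := (abs_le.1 (mulf_diff z w h x hx.1 hx.2.le)).2
  have h2 : (if x < z then (1:ℝ) else 0) ≤ if w ≤ z then 1 else 0 := by
    have := hx.1
    split_ifs <;> linarith
  unfold fder; linarith

lemma step_ge (z w h : ℝ) (hh : 0 ≤ h) :
    h * (w * f z w + (if w ≤ z - h then 1 else 0) - T z / S - h * (S + 2 * |w|)) ≤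
    f z (w + h) - f z w := by
  have := incr_ge z w (w + h)
    (w * f z w + (if w ≤ z - h then 1 else 0) - T z / S - h * (S + 2 * |w|)) (by linarith) ?_
  · linarith
  intro x hx
  have h1 := (abs_le.1 (mulf_diff z w h x hx.1 hx.2.le)).1
  have h2 : (if w ≤ z - h then (1:ℝ) else 0) ≤ if x < z then 1 else 0 := by
    have := hx.2
    split_ifs <;> linarith
  unfold fder; linarith

/-- Poisson weights. -/
noncomputable def po (l : ℝ) (k : ℕ) : ℝ := Real.exp (-l) * l ^ k / k.factorial

lemma po_nonneg (l : ℝ) (hl : 0 < l) (k : ℕ) : 0 ≤ po l k := by unfold po; positivity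

lemma po_sum (l : ℝ) : HasSum (po l) 1 := by
  have := (NormedSpace.expSeries_div_hasSum_exp (𝔸 := ℝ) l).mul_left (Real.exp (-l))
  rw [← Real.exp_eq_exp_ℝ, ← Real.exp_add, neg_add_cancel, Real.exp_zero] at this
  exact hs_congr this (fun k => by unfold po; ring) rfl

lemma po_shift (l : ℝ) (g : ℕ → ℝ) (s : ℝ) (h : HasSum (fun k => po l k * g (k + 1)) s) :
    HasSum (fun k => po l k * (k * g k)) (l * s) := by
  have h1 := h.mul_left l
  rw [← hasSum_nat_add_iff' 1]
  simp only [Finset.sum_range_one, Nat.cast_zero, zero_mul, mul_zero, sub_zero]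
  refine hs_congr h1 (fun k => ?_) rfl
  unfold po
  rw [Nat.factorial_succ, pow_succ]
  push_cast
  field_simp

lemma po_summable (l : ℝ) (hl : 0 < l) (g : ℕ → ℝ) (K : ℝ) (hg : ∀ k, |g k| ≤ K) :
    Summable (fun k => po l k * g k) := by
  refine Summable.of_norm_bounded ((po_sum l).summable.mul_right K) ?_
  intro k
  rw [Real.norm_eq_abs, abs_mul, abs_of_nonneg (po_nonneg l hl k)]
  exact mul_le_mul_of_nonneg_left (hg k) (po_nonneg l hl k)

noncomputable def W (l : ℝ) (k : ℕ) : ℝ := (k - l) / Real.sqrt l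

lemma W_succ (l : ℝ) (k : ℕ) : W l (k + 1) = W l k + 1 / Real.sqrt l := by
  unfold W; push_cast; ring

lemma W_var (l : ℝ) (hl : 0 < l) : HasSum (fun k => po l k * (W l k) ^ 2) 1 := by
  have h0 := po_sum l
  have h1 := po_shift l (fun _ => 1) 1 (by simpa using h0)
  have h2 := po_shift l (fun k => k) (l * 1 + 1) (by
    exact hs_congr (h1.add h0) (fun k => by push_cast; ring) rfl)
  have h3 := ((h2.add (h1.mul_left (-2 * l))).add (h0.mul_left (l ^ 2))).mul_left (1 / l)
  refine hs_congr h3 (fun k => ?_) ?_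
  · unfold W; rw [div_pow, Real.sq_sqrt hl.le]; ring
  · field_simp; ring

lemma W_abs (l : ℝ) (hl : 0 < l) :
    ∃ m ≤ 1, HasSum (fun k => po l k * |W l k|) m := by
  have hb : ∀ k, po l k * |W l k| ≤ (po l k + po l k * (W l k) ^ 2) / 2 := by
    intro k
    have := po_nonneg l hl k
    have h2 : |W l k| ≤ (1 + (W l k) ^ 2) / 2 := by
      rw [← sq_abs]; nlinarith [sq_nonneg (|W l k| - 1)]
    nlinarith
  have hs := ((po_sum l).add (W_var l hl)).div_const 2
  have hS : Summable (fun k => po l k * |W l k|) :=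
    Summable.of_nonneg_of_le (fun k => mul_nonneg (po_nonneg l hl k) (abs_nonneg _)) hb hs.summable
  refine ⟨_, ?_, hS.hasSum⟩
  have := hasSum_le hb hS.hasSum hs
  linarith

lemma stein (l z : ℝ) (hl : 0 < l) :
    ∃ s, HasSum (fun k => po l k * (W l k * f z (W l k))) s ∧
      HasSum (fun k => po l k * (f z (W l k + 1 / Real.sqrt l) - f z (W l k)))
        (1 / Real.sqrt l * s) := by
  have hb : ∀ w, |f z w| ≤ S := fun w => by rw [abs_of_nonneg (f_nonneg _ _)]; exact f_le _ _
  have hA := (po_summable l hl (fun k => f z (W l k)) S (fun k => hb _)).hasSum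
  have hB := (po_summable l hl (fun k => f z (W l (k + 1))) S (fun k => hb _)).hasSum
  have hC := (po_summable l hl (fun k => W l k * f z (W l k)) 1 (fun k => abs_mul_f_le _ _)).hasSum
  have hD := po_shift l (fun k => f z (W l k)) _ hB
  refine ⟨_, hC, ?_⟩
  have hE := hB.sub hA
  have hF := ((hD.mul_left (1 / l)).sub hA)
  have hs : Real.sqrt l ≠ 0 := (Real.sqrt_pos.2 hl).ne'
  have hG := hC.mul_left (1 / Real.sqrt l)
  have e : (fun k => 1 / l * (po l k * (k * f z (W l k))) - po l k * f z (W l k)) =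
      fun k => 1 / Real.sqrt l * (po l k * (W l k * f z (W l k))) := by
    funext k
    have : W l k / Real.sqrt l = (k - l) / l := by
      unfold W; rw [div_div, Real.mul_self_sqrt hl.le]
    have h2 : (k:ℝ) / l = W l k / Real.sqrt l + 1 := by rw [this]; field_simp; ring
    calc _ = po l k * f z (W l k) * (k / l) - po l k * f z (W l k) := by ring
      _ = _ := by rw [h2]; ring
  simp only [e] at hF
  rw [hG.unique hF]
  refine hs_congr hE (fun k => ?_) ?_
  · rw [W_succ]; ring
  · field_simp

lemma ind_summable (l z : ℝ) (hl : 0 < l) :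
    HasSum (fun k => po l k * (if W l k ≤ z then 1 else 0))
      (∑' k, po l k * (if W l k ≤ z then 1 else 0)) :=
  (po_summable l hl (fun k => if W l k ≤ z then 1 else 0) 1
    (fun k => by split_ifs <;> simp)).hasSum

lemma lower (l z : ℝ) (hl : 0 < l) :
    T z / S - 1 / Real.sqrt l * (S + 2) ≤ ∑' k, po l k * (if W l k ≤ z then 1 else 0) := by
  obtain ⟨s, h1, h2⟩ := stein l z hl
  obtain ⟨m, hm, h3⟩ := W_abs l hl
  have hh : 0 < 1 / Real.sqrt l := by have := Real.sqrt_pos.2 hl; positivity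
  set h := 1 / Real.sqrt l
  have h4 := ((((h1.add (ind_summable l z hl)).sub ((po_sum l).mul_right (T z / S))).add
    ((((po_sum l).mul_right S).add (h3.mul_left 2)).mul_left h))).mul_left h
  have h5 := hasSum_le (fun k => ?_) h2 h4
  · have h6 := le_of_mul_le_mul_left h5 hh
    have h7 := mul_le_mul_of_nonneg_left hm hh.le
    nlinarith
  · have := mul_le_mul_of_nonneg_left (step_le z (W l k) h hh.le) (po_nonneg l hl k)
    linarith

lemma upper (l z : ℝ) (hl : 0 < l) :
    ∑' k, po l k * (if W l k ≤ z - 1 / Real.sqrt l then 1 else 0) ≤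
      T z / S + 1 / Real.sqrt l * (S + 2) := by
  obtain ⟨s, h1, h2⟩ := stein l z hl
  obtain ⟨m, hm, h3⟩ := W_abs l hl
  have hh : 0 < 1 / Real.sqrt l := by have := Real.sqrt_pos.2 hl; positivity
  set h := 1 / Real.sqrt l
  have h4 := ((((h1.add (ind_summable l (z - h) hl)).sub ((po_sum l).mul_right (T z / S))).sub
    ((((po_sum l).mul_right S).add (h3.mul_left 2)).mul_left h))).mul_left h
  have h5 := hasSum_le (fun k => ?_) h4 h2
  · have h6 := le_of_mul_le_mul_left h5 hh
    have h7 := mul_le_mul_of_nonneg_left hm hh.le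
    nlinarith
  · have := mul_le_mul_of_nonneg_left (step_ge z (W l k) h hh.le) (po_nonneg l hl k)
    linarith

end PoissonStein

open PoissonStein in
/-- **Central limit theorem for Poisson variables**, with Berry–Esseen rate:
there is `C > 0` such that for all `λ ≥ 1` and all real `z`,
`|P(X ≤ λ + z√λ) - Φ(z)| ≤ C λ^{-1/2}` where `X` is Poisson with parameter `λ`
and `Φ` is the standard normal CDF. -/
theorem poisson_clt :
    ∃ C : ℝ, 0 < C ∧ ∀ lam z : ℝ, 1 ≤ lam →
      |(∑' k : ℕ, if (k : ℝ) ≤ lam + z * Real.sqrt lam then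
            Real.exp (-lam) * lam ^ k / k.factorial else 0) -
          (Real.sqrt (2 * Real.pi))⁻¹ * ∫ t in Set.Iic z, Real.exp (-t ^ 2 / 2)|
        ≤ C / Real.sqrt lam := by
  have hS := S_ge
  refine ⟨S + 3, by linarith, ?_⟩
  intro l z hl
  have hl0 : 0 < l := by linarith
  have hq := Real.sqrt_pos.2 hl0
  have e1 : (∑' k : ℕ, if (k : ℝ) ≤ l + z * Real.sqrt l then
      Real.exp (-l) * l ^ k / k.factorial else 0) =
      ∑' k, po l k * (if W l k ≤ z then 1 else 0) := by
    congr 1; funext k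
    have : (k : ℝ) ≤ l + z * Real.sqrt l ↔ W l k ≤ z := by
      unfold W; rw [div_le_iff₀ hq]; constructor <;> intro h <;> linarith
    simp only [this, po, mul_ite, mul_one, mul_zero]
  have e2 : (Real.sqrt (2 * Real.pi))⁻¹ * ∫ t in Set.Iic z, Real.exp (-t ^ 2 / 2) = T z / S := by
    unfold T S ga; rw [div_eq_inv_mul]
  rw [e1, e2]
  have h1 := lower l z hl0
  have h2 := upper l (z + 1 / Real.sqrt l) hl0
  rw [add_sub_cancel_right] at h2
  have hh : 0 < 1 / Real.sqrt l := by positivity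
  have h3 : T (z + 1 / Real.sqrt l) / S ≤ T z / S + 1 / Real.sqrt l := by
    have h4 := T_lip z (1 / Real.sqrt l) hh.le
    have hS0 : 0 < S := by linarith
    rw [div_add' _ _ _ hS0.ne']
    apply div_le_div_of_nonneg_right _ hS0.le
    nlinarith
  have e3 : (S + 3) / Real.sqrt l = 1 / Real.sqrt l * (S + 2) + 1 / Real.sqrt l := by ring
  rw [e3, abs_le]
  constructor <;> linarith
end

section
/- There exists a constant C > 0 such that for every n ≥ 1, every subset I ⊆ {1,…,n} with H(I) ≥ 3, and every real w, | P( C_I(σ) ≤ H(I) + w·√(H(I)) ) − Φ(w) | ≤ C · log(H(I)) / √(H(I)), where Φ(w) = (1/√(2π)) ∫_{−∞}^{w} e^{−t²/2} dt. -/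
open Finset

/-- the weight `z` of a multiset -/
def zw (s : Multiset ℕ) : ℕ := s.prod * ∏ i ∈ s.toFinset, (s.count i).factorial

lemma zw_prod_ext (s : Multiset ℕ) (T : Finset ℕ) (hT : s.toFinset ⊆ T) :
    ∏ i ∈ s.toFinset, (s.count i).factorial = ∏ i ∈ T, (s.count i).factorial := by
  apply Finset.prod_subset hT
  intro x _ hx
  rw [Multiset.mem_toFinset] at hx
  rw [Multiset.count_eq_zero_of_notMem hx]; rfl

lemma zw_cons (j : ℕ) (s : Multiset ℕ) : zw (j ::ₘ s) = j * (s.count j + 1) * zw s := by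
  unfold zw
  rw [zw_prod_ext s (insert j s.toFinset) (Finset.subset_insert _ _)]
  rw [zw_prod_ext (j ::ₘ s) (insert j s.toFinset) (by simp)]
  rw [← Finset.mul_prod_erase _ _ (Finset.mem_insert_self j s.toFinset),
    ← Finset.mul_prod_erase _ (fun i => (s.count i).factorial)
      (Finset.mem_insert_self j s.toFinset)]
  have : ∏ x ∈ (insert j s.toFinset).erase j, ((j ::ₘ s).count x).factorial
      = ∏ x ∈ (insert j s.toFinset).erase j, (s.count x).factorial := by
    apply Finset.prod_congr rfl
    intro x hx
    rw [Multiset.count_cons_of_ne (Finset.ne_of_mem_erase hx)]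
  rw [this, Multiset.count_cons_self, Multiset.prod_cons, Nat.factorial_succ]
  ring

lemma zw_pos {n : ℕ} (p : n.Partition) : 0 < zw p.parts := by
  unfold zw
  apply Nat.mul_pos
  · rw [Nat.pos_iff_ne_zero]
    intro h
    rw [Multiset.prod_eq_zero_iff] at h
    exact absurd (p.parts_pos h) (lt_irrefl _)
  · exact Finset.prod_pos fun i _ => Nat.factorial_pos _

lemma card_partition_mul {n : ℕ} (p : n.Partition) :
    (Finset.univ.filter fun σ : Equiv.Perm (Fin n) => σ.partition.parts = p.parts).card
      * zw p.parts = n.factorial := by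
  set m := p.parts.filter (fun i => 2 ≤ i) with hm
  have hsplit : p.parts = m + Multiset.replicate (n - m.sum) 1 := by
    have h1 : p.parts = m + p.parts.filter (fun i => ¬ 2 ≤ i) :=
      (Multiset.filter_add_not _ _).symm
    have h2 : p.parts.filter (fun i => ¬ 2 ≤ i)
        = Multiset.replicate (p.parts.filter (fun i => ¬ 2 ≤ i)).card 1 := by
      rw [Multiset.eq_replicate_card]
      intro b hb
      have := p.parts_pos (Multiset.mem_of_mem_filter hb)
      have := Multiset.of_mem_filter hb
      omega
    have h3 : n = m.sum + (p.parts.filter (fun i => ¬ 2 ≤ i)).card := by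
      conv_lhs => rw [← p.parts_sum, h1, h2]
      simp
    have h4 : (p.parts.filter (fun i => ¬ 2 ≤ i)).card = n - m.sum := by omega
    rw [h4] at h2
    rw [← h2]; exact h1
  have hsum : m.sum ≤ n := by
    have := p.parts_sum
    rw [hsplit] at this
    simp at this
    omega
  have h2 : ∀ a ∈ m, 2 ≤ a := fun a ha => Multiset.of_mem_filter ha
  have hset : (Finset.univ.filter fun σ : Equiv.Perm (Fin n) => σ.partition.parts = p.parts)
      = Finset.univ.filter fun σ : Equiv.Perm (Fin n) => σ.cycleType = m := by
    ext σ
    simp only [Finset.mem_filter, Finset.mem_univ, true_and]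
    constructor
    · intro h
      rw [← Equiv.Perm.filter_parts_partition_eq_cycleType, h]
    · intro h
      rw [Equiv.Perm.parts_partition, hsplit, ← h, Equiv.Perm.sum_cycleType, Fintype.card_fin]
  have hz : zw p.parts = (n - m.sum).factorial * m.prod *
      ∏ i ∈ m.toFinset, (m.count i).factorial := by
    have h1 : 1 ∉ m := fun h => by have := h2 1 h; omega
    unfold zw
    rw [zw_prod_ext p.parts (insert 1 m.toFinset), Finset.prod_insert (by simpa using h1)]
    · rw [hsplit]
      have : ∏ x ∈ m.toFinset, ((m + Multiset.replicate (n - m.sum) 1).count x).factorial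
        = ∏ x ∈ m.toFinset, (m.count x).factorial := by
        apply Finset.prod_congr rfl
        intro x hx
        have : (1:ℕ) ≠ x := by
          rintro rfl
          exact h1 (by simpa using hx)
        rw [Multiset.count_add, Multiset.count_replicate, if_neg this, add_zero]
      rw [this]
      simp [Multiset.count_eq_zero_of_notMem h1]
      ring
    · rw [hsplit]
      intro x hx
      simp only [Multiset.toFinset_add, Finset.mem_union, Multiset.mem_toFinset] at hx
      rcases hx with hx | hx
      · simp [hx]
      · simp [Multiset.eq_of_mem_replicate hx]
  rw [hset, hz]
  have := Equiv.Perm.card_of_cycleType_mul_eq (Fin n) m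
  rw [if_pos (by rw [Fintype.card_fin]; exact ⟨hsum, h2⟩), Fintype.card_fin] at this
  exact this

lemma minimalPeriod_eq_card_cycleOf {n : ℕ} (σ : Equiv.Perm (Fin n)) (x : Fin n)
    (hx : σ x ≠ x) : Function.minimalPeriod (⇑σ) x = (σ.cycleOf x).support.card := by
  have hc := Equiv.Perm.isCycle_cycleOf σ hx
  rw [← hc.orderOf]
  apply Nat.dvd_antisymm
  · apply Function.IsPeriodicPt.minimalPeriod_dvd
    show (⇑σ)^[orderOf (σ.cycleOf x)] x = x
    rw [← Equiv.Perm.coe_pow, ← Equiv.Perm.cycleOf_pow_apply_self, pow_orderOf_eq_one]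
    rfl
  · apply orderOf_dvd_of_pow_eq_one
    rw [hc.pow_eq_one_iff]
    refine ⟨x, ?_, ?_⟩
    · rwa [Equiv.Perm.cycleOf_apply_self]
    · rw [Equiv.Perm.cycleOf_pow_apply_self, Equiv.Perm.coe_pow]
      exact Function.iterate_minimalPeriod

lemma cycleCount_eq {n : ℕ} (σ : Equiv.Perm (Fin n)) (j : ℕ) (hj : 1 ≤ j) :
    cycleCount σ j = σ.partition.parts.count j := by
  unfold cycleCount
  apply Nat.div_eq_of_eq_mul_left hj
  rw [Equiv.Perm.parts_partition, Multiset.count_add, Multiset.count_replicate]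
  rcases Nat.lt_or_ge 1 j with h | h
  · rw [if_neg (by omega), add_zero, Equiv.Perm.cycleType_def, Multiset.count_map]
    have hmaps : ∀ x ∈ (Finset.univ.filter fun x => Function.minimalPeriod (⇑σ) x = j),
        σ.cycleOf x ∈ σ.cycleFactorsFinset.filter (fun c => j = c.support.card) := by
      intro x hx
      simp only [Finset.mem_filter, Finset.mem_univ, true_and] at hx
      have hne : σ x ≠ x := by
        intro hfix
        rw [Function.minimalPeriod_eq_one_iff_isFixedPt.mpr hfix] at hx
        omega
      simp only [Finset.mem_filter]
      refine ⟨?_, ?_⟩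
      · rw [Equiv.Perm.cycleOf_mem_cycleFactorsFinset_iff]
        simpa using hne
      · rw [← hx, minimalPeriod_eq_card_cycleOf σ x hne]
    rw [Finset.card_eq_sum_card_fiberwise hmaps]
    rw [Finset.sum_congr rfl (g := fun _ => j)]
    · rw [Finset.sum_const, smul_eq_mul]
      rfl
    · intro c hc
      simp only [Finset.mem_filter] at hc
      rw [hc.2]
      congr 1
      ext x
      simp only [Finset.mem_filter, Finset.mem_univ, true_and]
      constructor
      · rintro ⟨h1, h2⟩
        rw [← h2, Equiv.Perm.mem_support, Equiv.Perm.cycleOf_apply_self]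
        intro hfix
        rw [Function.minimalPeriod_eq_one_iff_isFixedPt.mpr hfix] at h1
        omega
      · intro hx
        have := (Equiv.Perm.cycle_is_cycleOf hx hc.1)
        refine ⟨?_, this.symm⟩
        have hne : σ x ≠ x := by
          have := Equiv.Perm.mem_cycleFactorsFinset_support_le hc.1 hx
          simpa using this
        rw [minimalPeriod_eq_card_cycleOf σ x hne, ← this]
  · obtain rfl : j = 1 := by omega
    rw [if_pos rfl, Multiset.count_eq_zero_of_notMem, zero_add, mul_one, ← Finset.card_univ]
    · rw [← Finset.card_sdiff_of_subset (Finset.subset_univ _)]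
      congr 1
      ext x
      simp [Function.minimalPeriod_eq_one_iff_isFixedPt, Function.IsFixedPt]
    · intro h
      have := Equiv.Perm.two_le_of_mem_cycleType h
      omega

/-- expectation as a sum over partitions -/
noncomputable def partE (n : ℕ) (F : Multiset ℕ → ℝ) : ℝ :=
  ∑ p : n.Partition, F p.parts / zw p.parts

lemma permE_eq_partE (n : ℕ) (F : Multiset ℕ → ℝ) :
    permE n (fun σ => F σ.partition.parts) = partE n F := by
  unfold permE partE
  let f : Equiv.Perm (Fin n) → n.Partition := fun σ =>
    ⟨σ.partition.parts, fun h => σ.partition.parts_pos h, by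
      rw [σ.partition.parts_sum, Fintype.card_fin]⟩
  rw [← Finset.sum_fiberwise (s := Finset.univ) (g := f), Finset.sum_div]
  apply Finset.sum_congr rfl
  intro p _
  have h1 : ∑ σ with f σ = p, F σ.partition.parts
      = (Finset.univ.filter fun σ : Equiv.Perm (Fin n) => σ.partition.parts = p.parts).card
        * F p.parts := by
    have : (Finset.univ.filter fun σ => f σ = p)
        = (Finset.univ.filter fun σ : Equiv.Perm (Fin n) => σ.partition.parts = p.parts) := by
      ext σ
      simp only [Finset.mem_filter, Finset.mem_univ, true_and, Nat.Partition.ext_iff]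
      rfl
    rw [this, Finset.sum_congr rfl (g := fun _ => F p.parts)]
    · simp
    · intro σ hσ
      simp only [Finset.mem_filter, Finset.mem_univ, true_and] at hσ
      rw [hσ]
  rw [h1]
  have h2 := card_partition_mul p
  have h3 := zw_pos p
  have h4 := n.factorial_pos
  rw [← h2] at h4 ⊢
  push_cast
  have h5 : 0 < (Finset.univ.filter
    fun σ : Equiv.Perm (Fin n) => σ.partition.parts = p.parts).card := by
    by_contra hh
    simp only [not_lt, Nat.le_zero] at hh
    rw [hh] at h4
    simp at h4
  have h6 : ((Finset.univ.filter
    fun σ : Equiv.Perm (Fin n) => σ.partition.parts = p.parts).card : ℝ) ≠ 0 := by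
    exact_mod_cast h5.ne'
  have h7 : ((zw p.parts : ℕ) : ℝ) ≠ 0 := by exact_mod_cast h3.ne'
  field_simp

lemma partE_count (n j : ℕ) (hj : 1 ≤ j) (hjn : j ≤ n) (F : Multiset ℕ → ℝ) :
    partE n (fun s => s.count j * F s) = (1 / j : ℝ) * partE (n - j) (fun s => F (j ::ₘ s)) := by
  unfold partE
  rw [Finset.mul_sum]
  symm
  apply Finset.sum_of_injOn
    (fun q : (n - j).Partition => (⟨j ::ₘ q.parts, by
      intro i hi
      rcases Multiset.mem_cons.mp hi with rfl | h
      · omega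
      · exact q.parts_pos h, by
      rw [Multiset.sum_cons, q.parts_sum]; omega⟩ : n.Partition))
  · intro q1 _ q2 _ h
    simp only [Nat.Partition.mk.injEq, Multiset.cons_inj_right] at h
    exact Nat.Partition.ext h
  · simp
  · intro p _ hp
    have : p.parts.count j = 0 := by
      by_contra hc
      apply hp
      have hmem : j ∈ p.parts := Multiset.count_ne_zero.mp hc
      refine ⟨⟨p.parts.erase j, fun h => p.parts_pos (Multiset.mem_of_mem_erase h), ?_⟩,
        by simp, ?_⟩
      · have := Multiset.cons_erase hmem
        have h2 := p.parts_sum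
        rw [← this, Multiset.sum_cons] at h2
        omega
      · apply Nat.Partition.ext
        simp [Multiset.cons_erase hmem]
    simp [this]
  · intro q _
    simp only [zw_cons, Multiset.count_cons_self]
    have h3 : ((zw q.parts : ℕ) : ℝ) ≠ 0 := by exact_mod_cast (zw_pos q).ne'
    have h4 : (j : ℝ) ≠ 0 := by exact_mod_cast (by omega : j ≠ 0)
    have h5 : ((q.parts.count j : ℝ) + 1) ≠ 0 := by positivity
    push_cast
    field_simp

lemma permE_const (n : ℕ) (c : ℝ) : permE n (fun _ => c) = c := by
  unfold permE
  have : (n.factorial : ℝ) ≠ 0 := by exact_mod_cast n.factorial_ne_zero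
  rw [Finset.sum_const, Finset.card_univ, Fintype.card_perm, Fintype.card_fin, nsmul_eq_mul]
  field_simp

/-- factorial moment -/
noncomputable def facM (J : Finset ℕ) (n k : ℕ) : ℝ :=
  partE n (fun s => ((∑ j ∈ J, s.count j).descFactorial k : ℝ))

lemma permE_descFactorial (J : Finset ℕ) (n k : ℕ) (hJ : ∀ j ∈ J, 1 ≤ j) :
    permE n (fun σ => ((cycleCountIn σ J).descFactorial k : ℝ)) = facM J n k := by
  unfold facM
  rw [← permE_eq_partE]
  congr 1
  ext σ
  unfold cycleCountIn
  rw [Finset.sum_congr rfl fun j hj => cycleCount_eq σ j (hJ j hj)]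

lemma facM_zero (J : Finset ℕ) (n : ℕ) : facM J n 0 = 1 := by
  unfold facM
  rw [← permE_eq_partE]
  simp [permE_const]

lemma facM_succ (J : Finset ℕ) (n k : ℕ) (hJ : ∀ j ∈ J, 1 ≤ j) :
    facM J n (k + 1) = ∑ j ∈ J, if j ≤ n then (1 / j : ℝ) * facM J (n - j) k else 0 := by
  have h1 : facM J n (k + 1) = ∑ j ∈ J, partE n (fun s => s.count j *
      (((∑ i ∈ J, s.count i) - 1).descFactorial k : ℝ)) := by
    unfold facM partE
    rw [Finset.sum_comm]
    apply Finset.sum_congr rfl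
    intro p _
    rw [← Finset.sum_div, ← Finset.sum_mul]
    congr 1
    rw [← Nat.cast_sum]
    beta_reduce
    generalize (∑ i ∈ J, p.parts.count i) = c
    cases c with
    | zero => simp
    | succ c => rw [Nat.succ_descFactorial_succ]; simp
  rw [h1]
  apply Finset.sum_congr rfl
  intro j hj
  split_ifs with hjn
  · rw [partE_count n j (hJ j hj) hjn]
    unfold facM
    congr 2
    ext s
    congr 2
    have : ∑ i ∈ J, (j ::ₘ s).count i = ∑ i ∈ J, s.count i + 1 := by
      simp only [Multiset.count_cons, Finset.sum_add_distrib]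
      simp [hj]
    rw [this]; simp
  · unfold partE
    apply Finset.sum_eq_zero
    intro p _
    have : p.parts.count j = 0 := by
      apply Multiset.count_eq_zero_of_notMem
      intro h
      exact hjn (Nat.Partition.le_of_mem_parts h)
    simp [this]

lemma facM_nonneg (J : Finset ℕ) (n k : ℕ) : 0 ≤ facM J n k := by
  unfold facM partE
  apply Finset.sum_nonneg
  intro p _
  positivity

lemma Hset_nonneg (J : Finset ℕ) : 0 ≤ Hset J := by
  unfold Hset
  apply Finset.sum_nonneg
  intro j _
  positivity

lemma facM_le (J : Finset ℕ) (hJ : ∀ j ∈ J, 1 ≤ j) (n k : ℕ) :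
    facM J n k ≤ Hset J ^ k := by
  induction k generalizing n with
  | zero => simp [facM_zero]
  | succ k ih =>
    rw [facM_succ J n k hJ, pow_succ', Hset, Finset.sum_mul]
    apply Finset.sum_le_sum
    intro j _
    have h0 : (0:ℝ) ≤ 1 / j := by positivity
    split_ifs
    · exact mul_le_mul_of_nonneg_left (ih _) h0
    · exact mul_nonneg h0 (pow_nonneg (Hset_nonneg J) k)

lemma facM_eq (J : Finset ℕ) (hJ : ∀ j ∈ J, 1 ≤ j) (n k : ℕ) (hk : ∀ j ∈ J, k * j ≤ n) :
    facM J n k = Hset J ^ k := by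
  induction k generalizing n with
  | zero => simp [facM_zero]
  | succ k ih =>
    rw [facM_succ J n k hJ, pow_succ', Hset, Finset.sum_mul]
    apply Finset.sum_congr rfl
    intro j hj
    have h1 := hk j hj
    have h3 : j ≤ n := by nlinarith
    rw [if_pos h3, ih (n - j)]
    · rfl
    · intro i hi
      have h2 := hk i hi
      rcases le_total i j with h | h
      · have : k * i ≤ k * j := Nat.mul_le_mul_left k h
        rw [add_mul] at h1
        omega
      · rw [add_mul] at h2
        omega

lemma permE_sum_hasSum (n : ℕ) (f : ℕ → Equiv.Perm (Fin n) → ℝ) (F : Equiv.Perm (Fin n) → ℝ)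
    (h : ∀ σ, HasSum (fun k => f k σ) (F σ)) : HasSum (fun k => permE n (f k)) (permE n F) := by
  unfold permE
  exact (hasSum_sum fun σ _ => h σ).div_const _

lemma permE_const_mul (n : ℕ) (c : ℝ) (F : Equiv.Perm (Fin n) → ℝ) :
    permE n (fun σ => c * F σ) = c * permE n F := by
  unfold permE
  rw [← Finset.mul_sum, mul_div_assoc]

lemma permE_mono (n : ℕ) (F G : Equiv.Perm (Fin n) → ℝ) (h : ∀ σ, F σ ≤ G σ) :
    permE n F ≤ permE n G := by
  unfold permE
  gcongr
  exact h _

/-- Newton coefficients -/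
noncomputable def newt (g : ℕ → ℝ) (k : ℕ) : ℝ := (fwdDiff 1)^[k] g 0

lemma newt_eq (g : ℕ → ℝ) (k : ℕ) :
    newt g k = ∑ i ∈ range (k + 1), ((-1 : ℝ) ^ (k - i) * k.choose i) * g i := by
  unfold newt
  rw [fwdDiff_iter_eq_sum_shift]
  apply Finset.sum_congr rfl
  intro i _
  simp

lemma newt_abs_le (g : ℕ → ℝ) (hg : ∀ i, |g i| ≤ 1) (k : ℕ) : |newt g k| ≤ 2 ^ k := by
  rw [newt_eq]
  have : (2:ℝ) ^ k = ∑ i ∈ range (k + 1), (k.choose i : ℝ) := by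
    rw [← Nat.cast_sum, Nat.sum_range_choose]; simp
  rw [this]
  apply (Finset.abs_sum_le_sum_abs _ _).trans
  apply Finset.sum_le_sum
  intro i _
  rw [abs_mul, abs_mul, abs_pow, abs_neg, abs_one, one_pow, one_mul, Nat.abs_cast]
  exact mul_le_of_le_one_right (by positivity) (hg i)

lemma newt_expand (g : ℕ → ℝ) (c : ℕ) :
    HasSum (fun k => newt g k / k.factorial * (c.descFactorial k : ℝ)) (g c) := by
  have h := shift_eq_sum_fwdDiff_iter (1 : ℕ) g c 0
  simp only [smul_eq_mul, mul_one, zero_add, nsmul_eq_mul] at h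
  rw [h]
  have : ∑ k ∈ range (c + 1), (c.choose k : ℝ) * (fwdDiff 1)^[k] g 0
      = ∑ k ∈ range (c + 1), newt g k / k.factorial * (c.descFactorial k : ℝ) := by
    apply Finset.sum_congr rfl
    intro k _
    rw [Nat.descFactorial_eq_factorial_mul_choose, newt]
    have : (k.factorial : ℝ) ≠ 0 := by exact_mod_cast k.factorial_ne_zero
    push_cast
    field_simp
  rw [this]
  apply hasSum_sum_of_ne_finset_zero
  intro k hk
  have : c < k := by simpa using hk
  simp [Nat.descFactorial_eq_zero_iff_lt.mpr this]

lemma newt_poisson (g : ℕ → ℝ) (hg : ∀ i, |g i| ≤ 1) (l : ℝ) (hl : 0 ≤ l) :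
    HasSum (fun k => newt g k / k.factorial * l ^ k)
      (∑' k : ℕ, Real.exp (-l) * l ^ k / k.factorial * g k) := by
  have hs1 : Summable fun k : ℕ => ‖(l ^ k / k.factorial * g k : ℝ)‖ := by
    apply Summable.of_nonneg_of_le (fun _ => norm_nonneg _) _ (Real.summable_pow_div_factorial l)
    intro k
    rw [norm_mul, Real.norm_of_nonneg (by positivity)]
    exact mul_le_of_le_one_right (by positivity) (hg k)
  have hs2 : Summable fun k : ℕ => ‖((-l) ^ k / k.factorial : ℝ)‖ :=
    (Real.summable_pow_div_factorial (-l)).norm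
  have h3 := tsum_mul_tsum_eq_tsum_sum_antidiagonal_of_summable_norm hs1 hs2
  have hs := (summable_norm_sum_mul_antidiagonal_of_summable_norm hs1 hs2).of_norm
  have hexp : ∑' k : ℕ, ((-l) ^ k / k.factorial : ℝ) = Real.exp (-l) := by
    rw [Real.exp_eq_exp_ℝ, NormedSpace.exp_eq_tsum_div]
  rw [hexp] at h3
  have heq : (fun k => newt g k / k.factorial * l ^ k) = fun k => ∑ kl ∈ antidiagonal k,
      (l ^ kl.1 / kl.1.factorial * g kl.1) * ((-l) ^ kl.2 / kl.2.factorial) := by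
    ext k
    rw [newt_eq, Finset.Nat.sum_antidiagonal_eq_sum_range_succ_mk, Finset.sum_div, Finset.sum_mul]
    apply Finset.sum_congr rfl
    intro i hi
    have hi : i ≤ k := by simpa [Nat.lt_succ_iff] using hi
    simp only
    rw [Nat.cast_choose ℝ hi, neg_pow l]
    have h1 : (k.factorial : ℝ) ≠ 0 := by exact_mod_cast k.factorial_ne_zero
    have h2 : (i.factorial : ℝ) ≠ 0 := by exact_mod_cast i.factorial_ne_zero
    have h3 : ((k - i).factorial : ℝ) ≠ 0 := by exact_mod_cast (k - i).factorial_ne_zero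
    have h4 : l ^ k = l ^ i * l ^ (k - i) := by rw [← pow_add]; congr 1; omega
    rw [h4]
    field_simp
  rw [heq]
  have h5 : ∑' k : ℕ, Real.exp (-l) * l ^ k / k.factorial * g k
      = (∑' k : ℕ, l ^ k / k.factorial * g k) * Real.exp (-l) := by
    rw [← tsum_mul_right]
    congr 1; ext k; ring
  rw [h5, h3]
  exact hs.hasSum

lemma permE_newt (J : Finset ℕ) (n : ℕ) (hJ : ∀ j ∈ J, 1 ≤ j) (g : ℕ → ℝ) :
    HasSum (fun k => newt g k / k.factorial * facM J n k)
      (permE n (fun σ => g (cycleCountIn σ J))) := by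
  have := permE_sum_hasSum n _ _ (fun σ => newt_expand g (cycleCountIn σ J))
  simp only [permE_const_mul, permE_descFactorial J n _ hJ] at this
  exact this

lemma hasSum_exp_series (x : ℝ) : HasSum (fun k : ℕ => x ^ k / k.factorial) (Real.exp x) := by
  rw [Real.exp_eq_exp_ℝ]
  exact NormedSpace.expSeries_div_hasSum_exp x

lemma poisson_compare (J : Finset ℕ) (n : ℕ) (hJ : ∀ j ∈ J, 1 ≤ j) (B : ℝ)
    (hB : ∀ j ∈ J, B * j ≤ n) (g : ℕ → ℝ) (hg : ∀ i, |g i| ≤ 1) :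
    |permE n (fun σ => g (cycleCountIn σ J)) -
      ∑' k : ℕ, Real.exp (-Hset J) * Hset J ^ k / k.factorial * g k|
      ≤ Real.exp (-B) * Real.exp (2 * Real.exp 1 * Hset J) := by
  have hH := Hset_nonneg J
  have h1 := (permE_newt J n hJ g).sub (newt_poisson g hg (Hset J) hH)
  rw [← h1.tsum_eq, ← Real.norm_eq_abs]
  apply tsum_of_norm_bounded ((hasSum_exp_series (2 * Real.exp 1 * Hset J)).mul_left _)
  intro k
  rw [← mul_sub, Real.norm_eq_abs, abs_mul, abs_div, Nat.abs_cast]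
  rcases le_or_gt (k : ℝ) B with h | h
  · rw [facM_eq J hJ n k, sub_self, abs_zero, mul_zero]
    · positivity
    · intro j hj
      have := hB j hj
      have h2 : (k : ℝ) * j ≤ B * j := by gcongr
      exact_mod_cast h2.trans this
  · have h2 : |facM J n k - Hset J ^ k| ≤ Hset J ^ k := by
      rw [abs_le]
      have := facM_le J hJ n k
      have := facM_nonneg J n k
      constructor <;> linarith
    have h3 := newt_abs_le g hg k
    have h4 : 1 ≤ Real.exp (-B) * Real.exp 1 ^ k := by
      rw [← Real.exp_nat_mul, ← Real.exp_add]
      apply Real.one_le_exp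
      linarith
    calc |newt g k| / k.factorial * |facM J n k - Hset J ^ k|
        ≤ 2 ^ k / k.factorial * Hset J ^ k := by gcongr
      _ ≤ (2 ^ k / k.factorial * Hset J ^ k) * (Real.exp (-B) * Real.exp 1 ^ k) :=
          le_mul_of_one_le_right (by positivity) h4
      _ = Real.exp (-B) * ((2 * Real.exp 1 * Hset J) ^ k / k.factorial) := by
          rw [mul_pow, mul_pow]; ring

lemma permE_three_pow_le (J : Finset ℕ) (n : ℕ) (hJ : ∀ j ∈ J, 1 ≤ j) :
    permE n (fun σ => (3 : ℝ) ^ (cycleCountIn σ J)) ≤ Real.exp (2 * Hset J) := by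
  have h1 := permE_newt J n hJ (fun k => (3 : ℝ) ^ k)
  have hn : ∀ k, newt (fun k => (3 : ℝ) ^ k) k = 2 ^ k := by
    intro k
    rw [newt_eq]
    have h2 : (2:ℝ) = 3 + -1 := by norm_num
    rw [h2, add_pow]
    apply Finset.sum_congr rfl
    intro i _
    ring
  refine hasSum_le (fun k => ?_) h1 (hasSum_exp_series (2 * Hset J))
  rw [hn, mul_pow, mul_div_right_comm]
  exact mul_le_mul_of_nonneg_left (facM_le J hJ n k) (by positivity)

/-- unnormalized Gaussian cdf -/
noncomputable def gG (w : ℝ) : ℝ := ∫ t in Set.Iic w, Real.exp (-t ^ 2 / 2)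

/-- total mass -/
noncomputable def gS : ℝ := Real.sqrt (2 * Real.pi)

lemma gauss_integrable : MeasureTheory.Integrable (fun t : ℝ => Real.exp (-t ^ 2 / 2)) := by
  have := integrable_exp_neg_mul_sq (b := 1 / 2) (by norm_num)
  refine this.congr (Filter.Eventually.of_forall fun t => ?_)
  simp only; congr 1; ring

lemma gauss_total : ∫ t : ℝ, Real.exp (-t ^ 2 / 2) = gS := by
  have := integral_gaussian (1 / 2)
  rw [gS]
  have h2 : Real.pi / (1 / 2) = 2 * Real.pi := by ring
  rw [h2] at this
  rw [← this]
  congr 1; ext t; congr 1; ring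

lemma gG_add (w : ℝ) : gG w + ∫ t in Set.Ioi w, Real.exp (-t ^ 2 / 2) = gS := by
  rw [← gauss_total, gG]
  exact intervalIntegral.integral_Iic_add_Ioi gauss_integrable.integrableOn
    gauss_integrable.integrableOn

lemma gG_neg (w : ℝ) : gG (-w) = gS - gG w := by
  rw [← gG_add w, gG]
  have := integral_comp_neg_Ioi w (fun t : ℝ => Real.exp (-t ^ 2 / 2))
  simp only [neg_sq] at this
  rw [← this]; ring

lemma gG_nonneg (w : ℝ) : 0 ≤ gG w :=
  MeasureTheory.integral_nonneg fun _ => (Real.exp_pos _).le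

lemma gG_le (w : ℝ) : gG w ≤ gS := by
  have := gG_nonneg (-w)
  rw [gG_neg] at this
  linarith

lemma gG_hasDerivAt (w : ℝ) : HasDerivAt gG (Real.exp (-w ^ 2 / 2)) w := by
  have hc : Continuous (fun t : ℝ => Real.exp (-t ^ 2 / 2)) := by fun_prop
  have h : gG = fun u => gG 0 + ∫ t in (0:ℝ)..u, Real.exp (-t ^ 2 / 2) := by
    ext u
    have := intervalIntegral.integral_Iic_sub_Iic (a := 0) (b := u)
      (gauss_integrable.integrableOn (s := Set.Iic 0)) (gauss_integrable.integrableOn)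
    rw [← this]; unfold gG; ring
  rw [h]
  exact (intervalIntegral.integral_hasDerivAt_right (hc.intervalIntegrable _ _)
    (hc.stronglyMeasurableAtFilter _ _) hc.continuousAt).const_add _

lemma gG_mono : Monotone gG :=
  monotone_of_deriv_nonneg (fun w => (gG_hasDerivAt w).differentiableAt) fun w => by
    rw [(gG_hasDerivAt w).deriv]; positivity

lemma gG_lip (u v : ℝ) (h : u ≤ v) : gG v - gG u ≤ v - u := by
  rcases h.eq_or_lt with rfl | h
  · simp
  · obtain ⟨c, _, hc⟩ := exists_hasDerivAt_eq_slope gG (fun w => Real.exp (-w ^ 2 / 2)) h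
      (fun w _ => (gG_hasDerivAt w).continuousAt.continuousWithinAt)
      (fun w _ => gG_hasDerivAt w)
    rw [eq_div_iff (by linarith)] at hc
    rw [← hc]
    apply mul_le_of_le_one_left (by linarith)
    rw [Real.exp_le_one_iff]
    nlinarith [sq_nonneg c]

lemma gS_ge : 1 ≤ gS := by
  rw [gS, Real.one_le_sqrt]
  linarith [Real.pi_gt_three]

lemma gS_le : gS ≤ 3 := by
  rw [gS, Real.sqrt_le_left (by norm_num)]
  linarith [Real.pi_lt_d2]

lemma mills_neg (w : ℝ) : -w * gG w ≤ Real.exp (-w ^ 2 / 2) := by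
  have hi : MeasureTheory.Integrable (fun t : ℝ => -t * Real.exp (-t ^ 2 / 2)) := by
    have := (integrable_mul_exp_neg_mul_sq (b := 1 / 2) (by norm_num)).neg
    refine this.congr (Filter.Eventually.of_forall fun t => ?_)
    simp only [Pi.neg_apply]
    rw [neg_mul]; ring_nf
  have hd : ∀ t ∈ Set.Iic w, HasDerivAt (fun t : ℝ => Real.exp (-t ^ 2 / 2))
      (-t * Real.exp (-t ^ 2 / 2)) t := by
    intro t _
    have h1 : HasDerivAt (fun t : ℝ => -t ^ 2 / 2) (-t) t := by
      have := ((hasDerivAt_pow 2 t).neg).div_const 2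
      exact this.congr_deriv (by push_cast; ring)
    exact h1.exp.congr_deriv (by ring)
  have hlim : Filter.Tendsto (fun t : ℝ => Real.exp (-t ^ 2 / 2)) Filter.atBot (nhds 0) := by
    apply Real.tendsto_exp_atBot.comp
    have h1 : Filter.Tendsto (fun t : ℝ => t ^ 2) Filter.atBot Filter.atTop :=
      by
      simpa [Function.comp_def] using (Filter.tendsto_pow_atTop (two_ne_zero (α := ℕ))).comp (Filter.tendsto_abs_atBot_atTop (G := ℝ))

    have h2 := (h1.atTop_div_const (by norm_num : (0:ℝ) < 2))
    have h3 := Filter.tendsto_neg_atTop_atBot.comp h2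
    refine h3.congr fun t => ?_
    simp only [Function.comp]; ring
  have h := MeasureTheory.integral_Iic_of_hasDerivAt_of_tendsto' hd hi.integrableOn hlim
  rw [sub_zero] at h
  rw [← h, gG, ← MeasureTheory.integral_const_mul]
  apply MeasureTheory.setIntegral_mono_on (gauss_integrable.integrableOn.const_mul _)
    hi.integrableOn measurableSet_Iic
  intro t ht
  have : t ≤ w := ht
  exact mul_le_mul_of_nonneg_right (by linarith) (Real.exp_pos _).le

/-- the Mills-type function -/
noncomputable def mil (w : ℝ) : ℝ := Real.exp (w ^ 2 / 2) * gG w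

lemma mil_nonneg (w : ℝ) : 0 ≤ mil w := mul_nonneg (Real.exp_pos _).le (gG_nonneg w)

lemma mil_mul (w : ℝ) : -w * mil w ≤ 1 := by
  have := mills_neg w
  have h2 : Real.exp (w ^ 2 / 2) * Real.exp (-w ^ 2 / 2) = 1 := by
    rw [← Real.exp_add]
    have : w ^ 2 / 2 + -w ^ 2 / 2 = 0 := by ring
    rw [this, Real.exp_zero]
  rw [← h2, mil]
  have := mul_le_mul_of_nonneg_left this (Real.exp_pos (w ^ 2 / 2)).le
  linarith

lemma mil_le (w : ℝ) (hw : w ≤ 0) : mil w ≤ 6 := by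
  rcases le_or_gt w (-1) with h | h
  · have := mil_mul w
    have := mil_nonneg w
    nlinarith
  · have h1 : Real.exp (w ^ 2 / 2) ≤ 2 := by
      have : Real.exp (w ^ 2 / 2) ≤ Real.exp (Real.log 2) := by
        apply Real.exp_le_exp.mpr
        have := Real.log_two_gt_d9
        nlinarith
      rwa [Real.exp_log (by norm_num)] at this
    have h2 := (gG_le w).trans gS_le
    unfold mil
    have := gG_nonneg w
    have := Real.exp_pos (w ^ 2 / 2)
    nlinarith

lemma mil_hasDerivAt (w : ℝ) : HasDerivAt mil (w * mil w + 1) w := by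
  have h1 : HasDerivAt (fun t : ℝ => t ^ 2 / 2) w w := by
    have := (hasDerivAt_pow 2 w).div_const 2
    exact this.congr_deriv (by push_cast; ring)
  have := h1.exp.mul (gG_hasDerivAt w)
  refine HasDerivAt.congr_deriv (f := mil) this ?_
  unfold mil
  rw [← Real.exp_add]
  have : w ^ 2 / 2 + -w ^ 2 / 2 = 0 := by ring
  rw [this, Real.exp_zero]; ring

/-- left branch of the Stein solution -/
noncomputable def stA (x w : ℝ) : ℝ := (gS - gG x) / gS * mil w
/-- right branch of the Stein solution -/
noncomputable def stB (x w : ℝ) : ℝ := gG x / gS * mil (-w)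

lemma stA_hasDerivAt (x w : ℝ) : HasDerivAt (stA x) (w * stA x w + (1 - gG x / gS)) w := by
  have := (mil_hasDerivAt w).const_mul ((gS - gG x) / gS)
  refine HasDerivAt.congr_deriv (f := stA x) this ?_
  have : gS ≠ 0 := by linarith [gS_ge]
  unfold stA
  field_simp

lemma stB_hasDerivAt (x w : ℝ) : HasDerivAt (stB x) (w * stB x w + (0 - gG x / gS)) w := by
  have h1 : HasDerivAt (fun w : ℝ => mil (-w)) ((-w * mil (-w) + 1) * (-1)) w :=
    (mil_hasDerivAt (-w)).comp w (hasDerivAt_neg w)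
  have := h1.const_mul (gG x / gS)
  refine HasDerivAt.congr_deriv (f := stB x) this ?_
  unfold stB
  ring

lemma stA_eq_stB (x : ℝ) : stA x x = stB x x := by
  unfold stA stB mil
  rw [gG_neg, neg_sq]
  ring

lemma stA_le_aux (x w : ℝ) (h : w ≤ x) :
    0 ≤ stA x w ∧ stA x w ≤ mil w ∧ stA x w ≤ mil (-w) := by
  have hS := gS_ge
  have h1 := gG_nonneg x
  have h2 := gG_le x
  have h3 := gG_mono h
  have h4 := gG_nonneg w
  have h5 := gG_le w
  have hS0 : 0 < gS := by linarith
  refine ⟨mul_nonneg (div_nonneg (by linarith) hS0.le) (mil_nonneg w), ?_, ?_⟩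
  · apply mul_le_of_le_one_left (mil_nonneg w)
    rw [div_le_one hS0]; linarith
  · unfold stA mil
    rw [gG_neg, neg_sq]
    have he := Real.exp_pos (w ^ 2 / 2)
    rw [div_mul_eq_mul_div, div_le_iff₀ hS0]
    have : (gS - gG x) * gG w ≤ (gS - gG w) * gS := by
      apply mul_le_mul <;> linarith
    nlinarith

lemma stB_le_aux (x w : ℝ) (h : x ≤ w) :
    0 ≤ stB x w ∧ stB x w ≤ mil w ∧ stB x w ≤ mil (-w) := by
  have : stB x w = stA (-x) (-w) := by
    unfold stA stB
    rw [gG_neg]; ring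
  rw [this]
  have := stA_le_aux (-x) (-w) (by linarith)
  rw [neg_neg] at this
  exact ⟨this.1, this.2.2, this.2.1⟩

lemma bound_of_aux (w y : ℝ) (h : 0 ≤ y ∧ y ≤ mil w ∧ y ≤ mil (-w)) :
    0 ≤ y ∧ y ≤ 6 ∧ |w * y| ≤ 1 := by
  obtain ⟨h0, h1, h2⟩ := h
  refine ⟨h0, ?_, ?_⟩
  · rcases le_total w 0 with hw | hw
    · exact h1.trans (mil_le w hw)
    · exact h2.trans (mil_le (-w) (by linarith))
  · rw [abs_mul, abs_of_nonneg h0]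
    rcases le_total w 0 with hw | hw
    · rw [abs_of_nonpos hw]
      exact (mul_le_mul_of_nonneg_left h1 (by linarith)).trans (mil_mul w)
    · rw [abs_of_nonneg hw]
      refine (mul_le_mul_of_nonneg_left h2 hw).trans ?_
      have := mil_mul (-w)
      rwa [neg_neg] at this

lemma step_lemma (a : ℝ → ℝ) (c u v : ℝ) (huv : u < v)
    (hd : ∀ w, HasDerivAt a (w * a w + c) w) (hc : |c| ≤ 1)
    (hb : ∀ w, u ≤ w → w ≤ v → 0 ≤ a w ∧ a w ≤ 6 ∧ |w * a w| ≤ 1) :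
    ∃ r, a v - a u = (v - u) * (u * a u + c + r) ∧ |r| ≤ (v - u) * (6 + 2 * |u|) := by
  obtain ⟨y, hy, hy2⟩ := exists_hasDerivAt_eq_slope a (fun w => w * a w + c) huv
    (fun w _ => (hd w).continuousAt.continuousWithinAt) (fun w _ => hd w)
  have hyu : u < y := hy.1
  have hyv : y < v := hy.2
  obtain ⟨z, hz, hz2⟩ := exists_hasDerivAt_eq_slope a (fun w => w * a w + c) hyu
    (fun w _ => (hd w).continuousAt.continuousWithinAt) (fun w _ => hd w)
  have hzu : u < z := hz.1
  have hzy : z < y := hz.2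
  rw [eq_div_iff (by linarith)] at hy2 hz2
  refine ⟨y * a y - u * a u, by rw [← hy2]; ring, ?_⟩
  have h1 : y * a y - u * a u = (y - u) * a y + u * ((z * a z + c) * (y - u)) := by
    rw [hz2]; ring
  have hby2 := hb y hyu.le hyv.le
  have bz := hb z hzu.le (by linarith)
  rw [h1]
  have h2 : |z * a z + c| ≤ 2 := (abs_add_le _ _).trans (by linarith [bz.2.2])
  calc |(y - u) * a y + u * ((z * a z + c) * (y - u))|
      ≤ |(y - u) * a y| + |u * ((z * a z + c) * (y - u))| := abs_add_le _ _
    _ = (y - u) * a y + |u| * (|z * a z + c| * (y - u)) := by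
        rw [abs_mul, abs_mul, abs_mul, abs_of_pos (by linarith : 0 < y - u),
          abs_of_nonneg hby2.1]
    _ ≤ (y - u) * 6 + |u| * (2 * (y - u)) := by
        have h5 : 0 ≤ y - u := by linarith
        have := mul_le_mul_of_nonneg_left hby2.2.1 h5
        have := mul_le_mul_of_nonneg_left (mul_le_mul_of_nonneg_right h2 h5) (abs_nonneg u)
        linarith
    _ = (y - u) * (6 + 2 * |u|) := by ring
    _ ≤ (v - u) * (6 + 2 * |u|) := by
        apply mul_le_mul_of_nonneg_right (by linarith)
        positivity

/-- Stein solution -/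
noncomputable def stF (x w : ℝ) : ℝ := if w ≤ x then stA x w else stB x w

lemma stF_bound (x w : ℝ) : 0 ≤ stF x w ∧ stF x w ≤ 6 ∧ |w * stF x w| ≤ 1 := by
  apply bound_of_aux
  unfold stF
  split_ifs with h
  · exact stA_le_aux x w h
  · exact stB_le_aux x w (by linarith)

lemma stF_right (x w : ℝ) (h : x ≤ w) : stF x w = stB x w := by
  unfold stF
  split_ifs with h2
  · obtain rfl : w = x := le_antisymm h2 h
    exact stA_eq_stB w
  · rfl

lemma gfrac (x : ℝ) : 0 ≤ gG x / gS ∧ gG x / gS ≤ 1 := by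
  have hS := gS_ge
  have hS0 : 0 < gS := by linarith
  exact ⟨div_nonneg (gG_nonneg x) hS0.le, (div_le_one hS0).mpr (gG_le x)⟩

lemma stF_step (x u v i : ℝ) (huv : u < v) (hi : (v ≤ x ∧ i = 1) ∨ (x ≤ u ∧ i = 0)) :
    ∃ r, stF x v - stF x u = (v - u) * (u * stF x u + (i - gG x / gS) + r) ∧
      |r| ≤ (v - u) * (6 + 2 * |u|) := by
  have hf := gfrac x
  rcases hi with ⟨h, rfl⟩ | ⟨h, rfl⟩
  · have e : ∀ w, w ≤ x → stF x w = stA x w := fun w hw => if_pos hw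
    rw [e v h, e u (by linarith)]
    apply step_lemma _ _ _ _ huv (stA_hasDerivAt x)
    · rw [abs_le]; constructor <;> linarith
    · intro w _ hw
      exact bound_of_aux _ _ (stA_le_aux x w (by linarith))
  · rw [stF_right x v (by linarith), stF_right x u h]
    apply step_lemma _ _ _ _ huv (stB_hasDerivAt x)
    · rw [abs_le]; constructor <;> linarith
    · intro w hw _
      exact bound_of_aux _ _ (stB_le_aux x w (by linarith))

/-- Poisson weights -/
noncomputable def poi (l : ℝ) (k : ℕ) : ℝ := Real.exp (-l) * l ^ k / k.factorial

lemma poi_nonneg (l : ℝ) (hl : 0 ≤ l) (k : ℕ) : 0 ≤ poi l k := by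
  unfold poi; positivity

lemma hasSum_of_eq {f g : ℕ → ℝ} {a b : ℝ} (h : HasSum f a) (h1 : ∀ k, g k = f k)
    (h2 : b = a) : HasSum g b := by
  rw [h2, funext h1]; exact h

lemma poi_sum (l : ℝ) : HasSum (poi l) 1 := by
  have := (hasSum_exp_series l).mul_left (Real.exp (-l))
  rw [← Real.exp_add, neg_add_cancel, Real.exp_zero] at this
  exact hasSum_of_eq this (fun k => by unfold poi; ring) rfl

lemma poi_succ (l : ℝ) (k : ℕ) : poi l (k + 1) * ((k + 1 : ℕ) : ℝ) = l * poi l k := by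
  unfold poi
  rw [Nat.factorial_succ]
  have h1 : (k.factorial : ℝ) ≠ 0 := by exact_mod_cast k.factorial_ne_zero
  push_cast
  have : (k : ℝ) + 1 ≠ 0 := by positivity
  rw [pow_succ]
  field_simp

lemma poi_shift (l : ℝ) (F : ℕ → ℝ) (A : ℝ) (h : HasSum (fun k => poi l k * F (k + 1)) A) :
    HasSum (fun k => poi l k * (k * F k)) (l * A) := by
  have h2 := h.mul_left l
  have h3 := (hasSum_nat_add_iff (f := fun k => poi l k * (k * F k)) 1 (g := l * A)).mp
  simp only [Finset.sum_range_one, Nat.cast_zero, zero_mul, mul_zero, add_zero] at h3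
  apply h3
  refine hasSum_of_eq h2 (fun k => ?_) rfl
  rw [← mul_assoc, poi_succ]; ring

lemma poi_mean (l : ℝ) : HasSum (fun k => poi l k * k) l := by
  have := poi_shift l (fun _ => 1) 1 (by simpa using poi_sum l)
  simpa using this

lemma poi_var (l : ℝ) : HasSum (fun k => poi l k * ((k : ℝ) - l) ^ 2) l := by
  have h1 := poi_mean l
  have h0 := poi_sum l
  have h2 := poi_shift l (fun k => (k : ℝ)) (l + 1) (by
    simpa [mul_add] using h1.add h0)
  have h3 := (h2.sub (h1.mul_left (2 * l))).add (h0.mul_left (l ^ 2))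
  exact hasSum_of_eq h3 (fun k => by ring) (by ring)

lemma poi_summable_bdd (l : ℝ) (hl : 0 ≤ l) (X : ℕ → ℝ) (c : ℝ) (hX : ∀ k, |X k| ≤ c) :
    Summable (fun k => poi l k * X k) := by
  apply Summable.of_norm_bounded ((poi_sum l).mul_left c).summable
  intro k
  rw [norm_mul, Real.norm_eq_abs, Real.norm_eq_abs, abs_of_nonneg (poi_nonneg l hl k), mul_comm]
  exact mul_le_mul_of_nonneg_right (hX k) (poi_nonneg l hl k)

lemma poi_tsum_bdd (l : ℝ) (hl : 0 ≤ l) (X : ℕ → ℝ) (c : ℝ) (hX : ∀ k, |X k| ≤ c) :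
    |∑' k, poi l k * X k| ≤ c := by
  have := tsum_of_norm_bounded (f := fun k => poi l k * X k) ((poi_sum l).mul_left c) (by
    intro k
    rw [norm_mul, Real.norm_eq_abs, Real.norm_eq_abs, abs_of_nonneg (poi_nonneg l hl k), mul_comm]
    exact mul_le_mul_of_nonneg_right (hX k) (poi_nonneg l hl k))
  rwa [mul_one] at this

lemma poisson_normal (h l w : ℝ) (hh : 1 ≤ h) (hl : 0 ≤ l) (hlh : l ≤ h) :
    |(∑' k : ℕ, poi l k * (if (k : ℝ) ≤ h + w * Real.sqrt h then 1 else 0)) - gG w / gS|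
      ≤ (9 + 10 * (h - l)) / Real.sqrt h := by
  set s := Real.sqrt h with hs
  have hs1 : 1 ≤ s := Real.one_le_sqrt.mpr hh
  have hs0 : 0 < s := by linarith
  have hss : s * s = h := Real.mul_self_sqrt (by linarith)
  set N : ℤ := ⌊h + w * s⌋ with hN
  have hN1 : (N : ℝ) ≤ h + w * s := Int.floor_le _
  have hN2 : h + w * s < N + 1 := Int.lt_floor_add_one _
  set x : ℝ := (N + 1 - h) / s with hx
  have hxs : x * s = N + 1 - h := by rw [hx]; field_simp
  have hxw : w ≤ x := by
    rw [hx, le_div_iff₀ hs0]; linarith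
  have hxw2 : x - w ≤ 1 / s := by
    have : x ≤ w + 1 / s := by
      rw [hx, div_le_iff₀ hs0, add_mul, one_div, inv_mul_cancel₀ hs0.ne']
      linarith
    linarith
  set u : ℕ → ℝ := fun k => (k - h) / s with hu
  have hus : ∀ k, u k * s = k - h := fun k => by simp only [hu]; field_simp
  set i : ℕ → ℝ := fun k => if (k : ℝ) ≤ h + w * s then 1 else 0 with hi
  set φ := gG x / gS with hφ
  have huu : ∀ k, u (k + 1) - u k = 1 / s := by
    intro k
    simp only [hu]; push_cast; ring
  have hstep : ∀ k, ∃ r, stF x (u (k + 1)) - stF x (u k)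
      = (1 / s) * (u k * stF x (u k) + (i k - φ) + r) ∧ |r| ≤ (1 / s) * (6 + 2 * |u k|) := by
    intro k
    have := stF_step x (u k) (u (k + 1)) (i k) (by
      have := huu k
      have : 0 < 1 / s := by positivity
      linarith) (by
      by_cases hk : (k : ℝ) ≤ h + w * s
      · left
        refine ⟨?_, if_pos hk⟩
        have h1 : (k : ℤ) ≤ N := Int.le_floor.mpr (by exact_mod_cast hk)
        have h2 : (k : ℝ) ≤ N := by exact_mod_cast h1
        simp only [hu, hx]
        push_cast
        gcongr
      · right
        refine ⟨?_, if_neg hk⟩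
        have h1 : N < (k : ℤ) := Int.floor_lt.mpr (by push_cast; linarith)
        have h2 : (N : ℝ) + 1 ≤ k := by exact_mod_cast h1
        simp only [hu, hx]
        gcongr)
    rw [huu k] at this
    exact this
  choose r hr1 hr2 using hstep
  set F : ℕ → ℝ := fun k => stF x (u k) with hF
  have hFb : ∀ k, |F k| ≤ 6 := fun k => by
    have := stF_bound x (u k)
    rw [abs_of_nonneg this.1]; exact this.2.1
  have huFb : ∀ k, |u k * F k| ≤ 1 := fun k => (stF_bound x (u k)).2.2
  have hib : ∀ k, |i k| ≤ 1 := fun k => by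
    simp only [hi]; split_ifs <;> simp
  have hφb := gfrac x
  have sF := poi_summable_bdd l hl F 6 hFb
  have sF1 := poi_summable_bdd l hl (fun k => F (k + 1)) 6 (fun k => hFb _)
  have suF := poi_summable_bdd l hl (fun k => u k * F k) 1 huFb
  have si := poi_summable_bdd l hl i 1 hib
  -- bound on r
  have hu_abs : ∀ k, |u k| ≤ ((k - l) ^ 2 / h + 1) / 2 + (h - l) / s := by
    intro k
    have e1 : u k = (k - l) / s - (h - l) / s := by simp only [hu]; ring
    have e2 : |(h - l) / s| = (h - l) / s := abs_of_nonneg (div_nonneg (by linarith) hs0.le)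
    have e3 : |((k : ℝ) - l) / s| ≤ ((k - l) ^ 2 / h + 1) / 2 := by
      have : ((k : ℝ) - l) ^ 2 / h = (|((k : ℝ) - l) / s|) ^ 2 := by
        rw [sq_abs, div_pow, ← hss]; ring
      rw [this]
      nlinarith [sq_nonneg (|((k : ℝ) - l) / s| - 1)]
    rw [e1]
    have := abs_sub ((k - l) / s) ((h - l) / s)
    linarith
  have hsR : HasSum (fun k => poi l k * ((1 / s) * (6 + 2 * (((k - l) ^ 2 / h + 1) / 2
      + (h - l) / s)))) ((1 / s) * (6 + 2 * ((l / h + 1) / 2 + (h - l) / s))) := by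
    have h1 := (poi_var l).mul_left (1 / s * (1 / h))
    have h2 := (poi_sum l).mul_left (1 / s * (7 + 2 * ((h - l) / s)))
    exact hasSum_of_eq (h1.add h2) (fun k => by ring) (by ring)
  have hrle : ∀ k, ‖poi l k * r k‖ ≤ poi l k * ((1 / s) * (6 + 2 * (((k - l) ^ 2 / h + 1) / 2
      + (h - l) / s))) := by
    intro k
    rw [norm_mul, Real.norm_eq_abs, Real.norm_eq_abs, abs_of_nonneg (poi_nonneg l hl k)]
    apply mul_le_mul_of_nonneg_left _ (poi_nonneg l hl k)
    refine (hr2 k).trans ?_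
    have := hu_abs k
    gcongr
  have sr : Summable (fun k => poi l k * r k) := Summable.of_norm_bounded hsR.summable hrle
  have hR := tsum_of_norm_bounded hsR hrle
  rw [Real.norm_eq_abs] at hR
  set A := ∑' k, poi l k * (u k * F k) with hA
  set Bf := ∑' k, poi l k * F k with hBf
  set P := ∑' k, poi l k * i k with hP
  set R := ∑' k, poi l k * r k with hRdef
  have hAb : |A| ≤ 1 := poi_tsum_bdd l hl _ 1 huFb
  have hBb : |Bf| ≤ 6 := poi_tsum_bdd l hl _ 6 hFb
  have key1 := poi_shift l F _ sF1.hasSum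
  -- sum of F(k+1)
  have key2 : HasSum (fun k => poi l k * F (k + 1)) (Bf + (1 / s) * (A + (P - φ) + R)) := by
    have := sF.hasSum.add ((((suF.hasSum.add si.hasSum).sub ((poi_sum l).mul_left φ)).add
      sr.hasSum).mul_left (1 / s))
    refine hasSum_of_eq this (fun k => ?_) ?_
    · have : F (k + 1) = F k + (1 / s) * (u k * F k + (i k - φ) + r k) := by
        rw [← hr1 k]; simp only [hF]; ring
      rw [this]; ring
    · ring
  rw [key2.tsum_eq] at key1
  have key3 : HasSum (fun k => poi l k * (k * F k)) (s * A + h * Bf) := by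
    refine hasSum_of_eq ((suF.hasSum.mul_left s).add (sF.hasSum.mul_left h)) (fun k => ?_) rfl
    have : (k : ℝ) = u k * s + h := by rw [hus]; ring
    linear_combination (poi l k * F k) * this
  have key := key1.unique key3
  -- l (Bf + (A + P - φ + R)/s) = s A + h Bf
  have key' : h * (P - φ) = (h - l) * (P - φ) + (h - l) * A - l * R + s * (h - l) * Bf := by
    have e : l * s * Bf + l * (A + (P - φ) + R) = s * s * A + h * s * Bf := by
      have := congrArg (fun z => s * z) key
      have e2 : s * (l * (Bf + 1 / s * (A + (P - φ) + R)))
        = l * s * Bf + l * (A + (P - φ) + R) := by field_simp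
      rw [e2] at this
      rw [this]; ring
    rw [hss] at e
    linarith
  have hP1 : 0 ≤ P := tsum_nonneg fun k => mul_nonneg (poi_nonneg l hl k) (by
    simp only [hi]; split_ifs <;> norm_num)
  have hP2 : P ≤ 1 := (le_abs_self _).trans (poi_tsum_bdd l hl _ 1 hib)
  have hPφ : |P - φ| ≤ 1 := by rw [abs_le]; constructor <;> linarith [hφb.1, hφb.2]
  have hd : 0 ≤ h - l := by linarith
  have hRb : |R| ≤ (1 / s) * (8 + 2 * (h - l)) := by
    refine hR.trans ?_
    have h1 : l / h ≤ 1 := by rw [div_le_one (by linarith)]; exact hlh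
    have h2 : (h - l) / s ≤ h - l := div_le_self hd hs1
    apply mul_le_mul_of_nonneg_left _ (by positivity)
    linarith
  have hmain : |P - φ| ≤ (8 + 10 * (h - l)) / s := by
    have h1 : h * |P - φ| ≤ 2 * (h - l) + h * ((1 / s) * (8 + 2 * (h - l))) + s * (h - l) * 6 := by
      rw [← abs_of_pos (by linarith : 0 < h), ← abs_mul, key', abs_of_pos (by linarith : 0 < h)]
      have a1 : |(h - l) * (P - φ)| ≤ h - l := by
        rw [abs_mul, abs_of_nonneg hd]; exact mul_le_of_le_one_right hd hPφ
      have a2 : |(h - l) * A| ≤ h - l := by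
        rw [abs_mul, abs_of_nonneg hd]; exact mul_le_of_le_one_right hd hAb
      have a3 : |l * R| ≤ h * ((1 / s) * (8 + 2 * (h - l))) := by
        rw [abs_mul, abs_of_nonneg hl]
        exact mul_le_mul hlh hRb (abs_nonneg _) (by linarith)
      have a4 : |s * (h - l) * Bf| ≤ s * (h - l) * 6 := by
        rw [abs_mul, abs_of_nonneg (by positivity : 0 ≤ s * (h - l))]
        exact mul_le_mul_of_nonneg_left hBb (by positivity)
      have b1 := abs_add_le ((h - l) * (P - φ) + (h - l) * A - l * R) (s * (h - l) * Bf)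
      have b2 := abs_sub ((h - l) * (P - φ) + (h - l) * A) (l * R)
      have b3 := abs_add_le ((h - l) * (P - φ)) ((h - l) * A)
      linarith
    rw [le_div_iff₀ hs0]
    have e1 : h * ((1 / s) * (8 + 2 * (h - l))) = s * (8 + 2 * (h - l)) := by
      rw [← hss]; field_simp
    rw [e1, ← hss] at h1
    rw [hss] at h1
    have h2 : s * (|P - φ| * s) ≤ s * (8 + 10 * (h - l)) := by
      calc s * (|P - φ| * s) = h * |P - φ| := by rw [← hss]; ring
        _ ≤ _ := h1
        _ ≤ _ := by nlinarith
    exact le_of_mul_le_mul_left h2 hs0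
  have hφw : |φ - gG w / gS| ≤ 1 / s := by
    have hS := gS_ge
    rw [hφ, ← sub_div, abs_of_nonneg (div_nonneg (by linarith [gG_mono hxw]) (by linarith))]
    refine (div_le_self (by linarith [gG_mono hxw]) hS).trans ?_
    exact (gG_lip w x hxw).trans hxw2
  calc |P - gG w / gS| = |(P - φ) + (φ - gG w / gS)| := by congr 1; ring
    _ ≤ |P - φ| + |φ - gG w / gS| := abs_add_le _ _
    _ ≤ (8 + 10 * (h - l)) / s + 1 / s := add_le_add hmain hφw
    _ = (9 + 10 * (h - l)) / s := by ring

open Classical in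
lemma permP_eq (n : ℕ) (E : Equiv.Perm (Fin n) → Prop) :
    permP n E = permE n (fun σ => if E σ then 1 else 0) := by
  unfold permP permE
  rw [Nat.card_eq_fintype_card, Fintype.card_subtype, Finset.sum_boole]

lemma harm_tail (a n : ℕ) (ha : 1 ≤ a) (han : a ≤ n) :
    ∑ j ∈ Finset.Icc a n, (1 : ℝ) / j ≤ 1 + Real.log (n / a) := by
  induction n, han using Nat.le_induction with
  | base =>
    have h0 : (a : ℝ) ≠ 0 := by positivity
    have h1 : (1 : ℝ) ≤ a := by exact_mod_cast ha
    rw [Finset.Icc_self, Finset.sum_singleton, div_self h0, Real.log_one, add_zero]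
    rw [div_le_one (by linarith)]; exact h1
  | succ n han ih =>
    rw [Finset.sum_Icc_succ_top (by omega)]
    have ha0 : (0 : ℝ) < a := by positivity
    have hn0 : (0 : ℝ) < n := by
      have : 0 < n := by omega
      exact_mod_cast this
    have h1 := Real.one_sub_inv_le_log_of_pos (x := ((n : ℝ) + 1) / n) (by positivity)
    rw [Real.log_div (by positivity) (by positivity)] at h1 ih ⊢
    push_cast
    have h2 : 1 - (((n : ℝ) + 1) / n)⁻¹ = 1 / (n + 1) := by field_simp; ring
    rw [h2] at h1
    linarith

lemma Hset_tail (D : Finset ℕ) (n : ℕ) (B : ℝ) (hB : 1 ≤ B) (hD : D ⊆ Finset.Icc 1 n)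
    (h : ∀ j ∈ D, (n : ℝ) < B * j) : Hset D ≤ 1 + Real.log B := by
  have hlog := Real.log_nonneg hB
  rcases D.eq_empty_or_nonempty with rfl | hne
  · simp [Hset]; linarith
  · set a := D.min' hne with ha
    have haD : a ∈ D := D.min'_mem hne
    have ha1 := Finset.mem_Icc.mp (hD haD)
    have hsub : D ⊆ Finset.Icc a n := fun j hj =>
      Finset.mem_Icc.mpr ⟨D.min'_le j hj, (Finset.mem_Icc.mp (hD hj)).2⟩
    have h1 : Hset D ≤ ∑ j ∈ Finset.Icc a n, (1 : ℝ) / j :=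
      Finset.sum_le_sum_of_subset_of_nonneg hsub fun j _ _ => by positivity
    have h2 := harm_tail a n ha1.1 ha1.2
    have ha0 : (0 : ℝ) < a := by
      have : 0 < a := by omega
      exact_mod_cast this
    have hn0 : (0 : ℝ) < n := by
      have : 0 < n := by omega
      exact_mod_cast this
    have h3 : Real.log (n / a) ≤ Real.log B := by
      apply Real.log_le_log (by positivity)
      rw [div_le_iff₀ ha0]
      exact (h a haD).le
    linarith

lemma permE_sub (n : ℕ) (F G : Equiv.Perm (Fin n) → ℝ) :
    permE n (fun σ => F σ - G σ) = permE n F - permE n G := by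
  unfold permE
  rw [Finset.sum_sub_distrib, sub_div]

/-- **Central limit theorem for `C_I(σ)`.** There is `C > 0` such that for every
`n ≥ 1`, every `I ⊆ [n]` with `H(I) ≥ 3`, and every real `w`,
`|P(C_I(σ) ≤ H(I) + w √H(I)) - Φ(w)| ≤ C log(H(I)) / √H(I)`. -/
theorem clt_cycles :
    ∃ C : ℝ, 0 < C ∧ ∀ (n : ℕ) (I : Finset ℕ) (w : ℝ), 1 ≤ n →
      I ⊆ Finset.Icc 1 n → 3 ≤ Hset I →
      |permP n (fun σ => (cycleCountIn σ I : ℝ) ≤ Hset I + w * Real.sqrt (Hset I)) -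
          (Real.sqrt (2 * Real.pi))⁻¹ * ∫ t in Set.Iic w, Real.exp (-t ^ 2 / 2)|
        ≤ C * Real.log (Hset I) / Real.sqrt (Hset I) := by
  refine ⟨100, by norm_num, ?_⟩
  intro n I w _ hI h3
  set h := Hset I with hh
  set s := Real.sqrt h with hs
  have hs1 : 1 ≤ s := Real.one_le_sqrt.mpr (by linarith)
  have hs0 : 0 < s := by linarith
  have hss : s * s = h := Real.mul_self_sqrt (by linarith)
  have hsh : s ≤ h := by nlinarith
  have hlog1 : 1 ≤ Real.log h := by
    rw [Real.le_log_iff_exp_le (by linarith)]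
    linarith [Real.exp_one_lt_d9]
  set B : ℝ := 10 * h with hB
  set J := I.filter (fun j : ℕ => B * j ≤ n) with hJ
  set D := I.filter (fun j : ℕ => ¬ B * j ≤ n) with hD
  have hI1 : ∀ j ∈ I, 1 ≤ j := fun j hj => (Finset.mem_Icc.mp (hI hj)).1
  have hJ1 : ∀ j ∈ J, 1 ≤ j := fun j hj => hI1 j (Finset.mem_of_mem_filter j hj)
  have hD1 : ∀ j ∈ D, 1 ≤ j := fun j hj => hI1 j (Finset.mem_of_mem_filter j hj)
  have hHsum : Hset J + Hset D = h := Finset.sum_filter_add_sum_filter_not I _ _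
  have hCsum : ∀ σ : Equiv.Perm (Fin n),
      cycleCountIn σ J + cycleCountIn σ D = cycleCountIn σ I := fun σ =>
    Finset.sum_filter_add_sum_filter_not I _ _
  set L := 1 + Real.log B with hL
  have hDL : Hset D ≤ L := Hset_tail D n B (by linarith) ((Finset.filter_subset _ _).trans hI)
    fun j hj => by
      have := (Finset.mem_filter.mp hj).2
      linarith
  have hL5 : L ≤ 5 * Real.log h := by
    rw [hL, hB, Real.log_mul (by norm_num) (by linarith)]
    have : Real.log 10 ≤ 3 := by
      have h1 : Real.log 10 ≤ Real.log (2 ^ 4) := Real.log_le_log (by norm_num) (by norm_num)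
      rw [Real.log_pow] at h1
      have := Real.log_two_lt_d9
      push_cast at h1
      linarith
    linarith
  have hJ0 := Hset_nonneg J
  have hD0 := Hset_nonneg D
  set K := 2 * L + Real.log h with hK
  have hK0 : 0 ≤ K := by linarith
  -- the Poisson comparison
  have hcmp : ∀ v : ℝ, |permE n (fun σ => if (cycleCountIn σ J : ℝ) ≤ h + v * s then 1 else 0)
      - gG v / gS| ≤ (10 + 10 * L) / s := by
    intro v
    have h1 := poisson_compare J n hJ1 B (fun j hj => (Finset.mem_filter.mp hj).2)
      (fun k => if (k : ℝ) ≤ h + v * s then 1 else 0) (fun k => by beta_reduce; split_ifs <;> simp)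
    have h2 := poisson_normal h (Hset J) v (by linarith) hJ0 (by linarith)
    have h3 : Real.exp (-B) * Real.exp (2 * Real.exp 1 * Hset J) ≤ 1 / s := by
      have e1 : Real.exp (-B) * Real.exp (2 * Real.exp 1 * Hset J) ≤ Real.exp (-h) := by
        rw [← Real.exp_add]
        apply Real.exp_le_exp.mpr
        have := Real.exp_one_lt_d9
        have h5 : 2 * Real.exp 1 * Hset J ≤ 6 * h :=
          mul_le_mul (by linarith) (by linarith) hJ0 (by norm_num)
        linarith
      have e2 : Real.exp (-h) ≤ 1 / s := by
        rw [Real.exp_neg, ← one_div]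
        apply one_div_le_one_div_of_le hs0
        have := Real.add_one_le_exp h
        linarith
      exact e1.trans e2
    have h4 : (9 + 10 * (h - Hset J)) / s ≤ (9 + 10 * L) / s := by
      gcongr
      linarith
    have e3 : (10 + 10 * L) / s = (9 + 10 * L) / s + 1 / s := by ring
    rw [e3]
    unfold poi at h2
    have := abs_sub_le (permE n (fun σ => if (cycleCountIn σ J : ℝ) ≤ h + v * s then 1 else 0))
      (∑' k : ℕ, Real.exp (-Hset J) * Hset J ^ k / k.factorial *
        (if (k : ℝ) ≤ h + v * s then 1 else 0)) (gG v / gS)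
    linarith
  have hΦ : (Real.sqrt (2 * Real.pi))⁻¹ * ∫ t in Set.Iic w, Real.exp (-t ^ 2 / 2)
      = gG w / gS := by
    unfold gG gS
    rw [div_eq_inv_mul]
  rw [hΦ, permP_eq]
  set P := permE n (fun σ => if (cycleCountIn σ I : ℝ) ≤ h + w * s then 1 else 0) with hP
  have hup : P ≤ permE n (fun σ => if (cycleCountIn σ J : ℝ) ≤ h + w * s then 1 else 0) := by
    apply permE_mono
    intro σ
    have h1 : (cycleCountIn σ J : ℝ) ≤ cycleCountIn σ I := by
      exact_mod_cast (Nat.le_add_right _ _).trans (hCsum σ).le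
    split_ifs
    · exact le_rfl
    · exfalso; linarith
    · norm_num
    · exact le_rfl
  have hlow : permE n (fun σ => if (cycleCountIn σ J : ℝ) ≤ h + (w - K / s) * s then 1 else 0)
      - 1 / h ≤ P := by
    have e1 : h + (w - K / s) * s = h + w * s - K := by field_simp; ring
    rw [e1]
    have h1 : permE n (fun σ => (if (cycleCountIn σ J : ℝ) ≤ h + w * s - K then (1:ℝ) else 0)
        - Real.exp (-K) * (3 : ℝ) ^ (cycleCountIn σ D)) ≤ P := by
      apply permE_mono
      intro σ
      have hc : (cycleCountIn σ J : ℝ) + cycleCountIn σ D = cycleCountIn σ I := by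
        exact_mod_cast hCsum σ
      have hpos : 0 ≤ Real.exp (-K) * (3 : ℝ) ^ (cycleCountIn σ D) := by positivity
      split_ifs with a1 a2 a2
      · linarith
      · have : K ≤ cycleCountIn σ D := by linarith
        have h5 : Real.exp K ≤ (3 : ℝ) ^ (cycleCountIn σ D) := by
          calc Real.exp K ≤ Real.exp (cycleCountIn σ D * 1) := by
                apply Real.exp_le_exp.mpr; linarith
            _ = Real.exp 1 ^ (cycleCountIn σ D) := Real.exp_nat_mul _ _
            _ ≤ 3 ^ (cycleCountIn σ D) := by
                gcongr
                linarith [Real.exp_one_lt_d9]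
        have h6 : 1 ≤ Real.exp (-K) * (3 : ℝ) ^ (cycleCountIn σ D) := by
          calc (1:ℝ) = Real.exp (-K) * Real.exp K := by rw [← Real.exp_add]; simp
            _ ≤ _ := by gcongr
        linarith
      · linarith
      · linarith
    rw [permE_sub, permE_const_mul] at h1
    have h2 := permE_three_pow_le D n hD1
    have h4 : Real.exp (-K) * permE n (fun σ => (3 : ℝ) ^ (cycleCountIn σ D)) ≤ 1 / h := by
      calc _ ≤ Real.exp (-K) * Real.exp (2 * L) := by
            gcongr
            exact h2.trans (Real.exp_le_exp.mpr (by linarith))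
        _ = Real.exp (-Real.log h) := by rw [← Real.exp_add, hK]; congr 1; ring
        _ = 1 / h := by rw [Real.exp_neg, Real.exp_log (by linarith), one_div]
    linarith
  have c1 := abs_le.mp (hcmp w)
  have c2 := abs_le.mp (hcmp (w - K / s))
  have hlip : gG w / gS - gG (w - K / s) / gS ≤ K / s := by
    have hKs : 0 ≤ K / s := by positivity
    have h1 := gG_lip (w - K / s) w (by linarith)
    have h2 := gG_mono (by linarith : w - K / s ≤ w)
    rw [← sub_div]
    refine (div_le_self (by linarith) gS_ge).trans (by linarith)
  have h1h : 1 / h ≤ 1 / s := one_div_le_one_div_of_le hs0 hsh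
  have hfin : (11 + 10 * L + K) / s ≤ 100 * Real.log h / s := by
    gcongr
    linarith
  have e4 : (11 + 10 * L + K) / s = (10 + 10 * L) / s + K / s + 1 / s := by ring
  have hKs : 0 ≤ K / s := by positivity
  have h1s : 0 ≤ 1 / s := by positivity
  rw [abs_le]
  constructor <;> linarith
end
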